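/- arXiv:1812.06058 — 4 statements merged into one kernel-verified Lean document; each statement's English description precedes it below -/
import Mathlib

section
/- The free product of two bi-orderable groups is bi-orderable; moreover, the bi-invariant order on G₁ * G₂ may be taken to extend given bi-invariant orders on G₁ and G₂ (i.e., there is a bi-invariant positive cone of G₁ * G₂ whose intersection with the canonical copy of Gᵢ is the given positive cone of Gᵢ, for i = 1, 2). -/
/-- A subset `P` of a group `G` is a (left-invariant) positive cone if `P · P ⊆ P`
and for every `g ∈ G` exactly one of `g = 1`, `g ∈ P`, `g⁻¹ ∈ P` holds. -/
def IsPosCone {G : Type*} [Group G] (P : Set G) : Prop :=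
  (∀ a ∈ P, ∀ b ∈ P, a * b ∈ P) ∧
  ∀ g : G, (g = 1 ∧ g ∉ P ∧ g⁻¹ ∉ P) ∨ (g ∈ P ∧ g ≠ 1 ∧ g⁻¹ ∉ P) ∨
    (g⁻¹ ∈ P ∧ g ≠ 1 ∧ g ∉ P)

/-- A bi-invariant positive cone: a positive cone that is also conjugation-invariant. -/
def IsBiPosCone {G : Type*} [Group G] (P : Set G) : Prop :=
  IsPosCone P ∧ ∀ g : G, ∀ p ∈ P, g * p * g⁻¹ ∈ P

/-- An additive cone: the set of positive elements of a translation-invariant linear order. -/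
structure IsAddCone {V : Type*} [AddGroup V] (C : Set V) : Prop where
  zero_notMem : (0 : V) ∉ C
  add_mem : ∀ x ∈ C, ∀ y ∈ C, x + y ∈ C
  mem_or_neg_mem : ∀ x, x ≠ 0 → x ∈ C ∨ -x ∈ C

/-- Functions whose first nonzero value exists and lies in `C`. -/
def lexCone {ι B : Type*} [LT ι] [Zero B] (C : Set B) : Set (ι → B) :=
  {f | ∃ n, (∀ i < n, f i = 0) ∧ f n ∈ C}

theorem IsAddCone.preimage_lexCone {ι B V : Type*} [LinearOrder ι] [AddGroup B] [AddGroup V]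
    {C : Set B} (hC : IsAddCone C) (c : V →+ (ι → B))
    (hc : ∀ v, v ≠ 0 → ∃ n, (∀ i < n, c v i = 0) ∧ c v n ≠ 0) :
    IsAddCone (c ⁻¹' lexCone C) where
  zero_notMem := by
    rintro ⟨n, -, hn⟩
    rw [map_zero] at hn
    exact hC.zero_notMem hn
  add_mem := by
    rintro x ⟨n, hn, hn'⟩ y ⟨m, hm, hm'⟩
    rcases lt_trichotomy n m with h | rfl | h
    · refine ⟨n, fun i hi => ?_, ?_⟩
      · simp [hn i hi, hm i (hi.trans h)]
      · simpa [hm n h] using hn'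
    · refine ⟨n, fun i hi => ?_, ?_⟩
      · simp [hn i hi, hm i hi]
      · simpa using hC.add_mem _ hn' _ hm'
    · refine ⟨m, fun i hi => ?_, ?_⟩
      · simp [hm i hi, hn i (hi.trans h)]
      · simpa [hn m h] using hm'
  mem_or_neg_mem := by
    intro x hx
    obtain ⟨n, hn, hn'⟩ := hc x hx
    refine (hC.mem_or_neg_mem _ hn').imp (fun h => ⟨n, hn, h⟩) fun h => ⟨n, fun i hi => ?_, ?_⟩
    · simp [hn i hi]
    · simpa using h

theorem isAddCone_posInt : IsAddCone {n : ℤ | 0 < n} where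
  zero_notMem := by simp
  add_mem := by intro x hx y hy; exact Int.add_pos hx hy
  mem_or_neg_mem := by intro x hx; simp only [Set.mem_ofPred_eq]; omega

/-- The elements of a ring whose left and right multiplications preserve `C`. -/
def mulStabilizer {A : Type*} [Ring A] (C : Set A) : Submonoid A where
  carrier := {u | ∀ x ∈ C, u * x ∈ C ∧ x * u ∈ C}
  one_mem' := by intro x hx; simpa using hx
  mul_mem' := by
    intro u v hu hv x hx
    rw [mul_assoc, ← mul_assoc x]
    exact ⟨(hu _ (hv _ hx).1).1, (hv _ (hu _ hx).2).2⟩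

theorem IsAddCone.isBiPosCone {A G : Type*} [Ring A] [Group G] {C : Set A} (hC : IsAddCone C)
    (φ : G →* A) (hφ : ∀ g, φ g ∈ mulStabilizer C) (hker : ∀ g, φ g = 1 → g = 1) :
    IsBiPosCone {g | 1 - φ g ∈ C} := by
  have hinv (g : G) : φ g * φ g⁻¹ = 1 := by rw [← map_mul, mul_inv_cancel, map_one]
  have hone : (1 : G) ∉ {g | 1 - φ g ∈ C} := by simpa using hC.zero_notMem
  have hmul : ∀ a ∈ {g | 1 - φ g ∈ C}, ∀ b ∈ {g | 1 - φ g ∈ C}, a * b ∈ {g | 1 - φ g ∈ C} := by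
    intro a ha b hb
    have : 1 - φ (a * b) = (1 - φ a) * φ b + (1 - φ b) := by rw [map_mul]; noncomm_ring
    rw [Set.mem_ofPred_eq, this]
    exact hC.add_mem _ (hφ b _ ha).2 _ hb
  have hnot (g : G) (hg : g ∈ {g | 1 - φ g ∈ C}) (hg' : g⁻¹ ∈ {g | 1 - φ g ∈ C}) : False :=
    hone (by simpa using hmul g hg _ hg')
  refine ⟨⟨hmul, fun g => ?_⟩, fun g p hp => ?_⟩
  · by_cases h1 : g = 1
    · subst h1
      exact Or.inl ⟨rfl, hone, by simpa only [inv_one] using hone⟩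
    · rcases hC.mem_or_neg_mem (1 - φ g) (fun h => h1 (hker g (sub_eq_zero.mp h).symm)) with h | h
      · exact Or.inr (Or.inl ⟨h, h1, hnot g h⟩)
      · have hg : g⁻¹ ∈ {g | 1 - φ g ∈ C} := by
          have : 1 - φ g⁻¹ = -(1 - φ g) * φ g⁻¹ := by
            rw [neg_mul, sub_mul, hinv]; noncomm_ring
          rw [Set.mem_ofPred_eq, this]
          exact (hφ _ _ h).2
        exact Or.inr (Or.inr ⟨hg, h1, fun h' => hnot g h' hg⟩)
  · have : 1 - φ (g * p * g⁻¹) = φ g * (1 - φ p) * φ g⁻¹ := by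
      rw [map_mul, map_mul, mul_sub, sub_mul, mul_one, hinv]
    rw [Set.mem_ofPred_eq, this]
    exact (hφ _ _ (hφ _ _ hp).1).2

theorem IsPosCone.mem_iff_of_map {G H : Type*} [Group G] [Group H] {P : Set G} {Q : Set H}
    (hP : IsPosCone P) (hQ : IsPosCone Q) (f : G →* H) (hf : ∀ g ∈ P, f g ∈ Q) (g : G) :
    f g ∈ Q ↔ g ∈ P := by
  refine ⟨fun h => ?_, hf g⟩
  have h1 := hP.2 g
  have h2 := hQ.2 (f g)
  have h3 := hf g⁻¹
  rw [map_inv] at h3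
  rcases h1 with ⟨rfl, -, -⟩ | h1 | h1
  · rw [map_one] at h h2
    tauto
  · exact h1.1
  · tauto

theorem IsBiPosCone.prod {G H : Type*} [Group G] [Group H] {P : Set G} {Q : Set H}
    (hP : IsBiPosCone P) (hQ : IsBiPosCone Q) :
    IsBiPosCone {x : G × H | x.1 ∈ P ∨ x.1 = 1 ∧ x.2 ∈ Q} := by
  refine ⟨⟨?_, ?_⟩, ?_⟩
  · rintro ⟨a, b⟩ (h | ⟨h, hb⟩) ⟨c, d⟩ (k | ⟨k, kd⟩) <;> simp only at *
    · exact Or.inl (hP.1.1 a h c k)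
    · subst k; exact Or.inl (by simpa using h)
    · subst h; exact Or.inl (by simpa using k)
    · subst h k; exact Or.inr ⟨by simp, hQ.1.1 b hb d kd⟩
  · rintro ⟨a, b⟩
    have h1 := hP.1.2 a
    have h2 := hQ.1.2 b
    simp only [Prod.mk_eq_one, Set.mem_ofPred_eq, Prod.fst_inv, Prod.snd_inv, inv_eq_one, ne_eq]
    tauto
  · rintro ⟨a, b⟩ ⟨c, d⟩ (h | ⟨h, hb⟩) <;> simp only at *
    · exact Or.inl (hP.2 a c h)
    · subst h; exact Or.inr ⟨by simp, hQ.2 b d hb⟩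

/-- A bi-invariant positive cone is the set of elements above `1` for a bi-invariant order. -/
theorem IsBiPosCone.exists_linearOrder {K : Type*} [Group K] {Q : Set K} (hQ : IsBiPosCone Q) :
    ∃ _ : LinearOrder K, MulLeftStrictMono K ∧ MulRightStrictMono K ∧ ∀ k, 1 < k ↔ k ∈ Q := by
  classical
  let r : K → K → Prop := fun a b => a⁻¹ * b ∈ Q
  have hirr : (1 : K) ∉ Q := by
    have := hQ.1.2 1
    tauto
  have : IsStrictTotalOrder K r :=
    { irrefl := fun a => by simpa [r] using hirr
      trans := fun a b c hab hbc => by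
        simpa [r, mul_assoc] using hQ.1.1 _ hab _ hbc
      trichotomous := fun a b hab hba => by
        have h := hQ.1.2 (a⁻¹ * b)
        simp only [r] at hab hba
        rw [mul_inv_rev, inv_inv, inv_mul_eq_one] at h
        tauto }
  refine ⟨linearOrderOfSTO r, ⟨fun c a b hab => ?_⟩, ⟨fun c a b hab => ?_⟩, fun k => ?_⟩
  · change (c * a)⁻¹ * (c * b) ∈ Q
    have : (c * a)⁻¹ * (c * b) = a⁻¹ * b := by group
    rw [this]
    exact hab
  · change (a * c)⁻¹ * (b * c) ∈ Q
    have : (a * c)⁻¹ * (b * c) = c⁻¹ * (a⁻¹ * b) * c⁻¹⁻¹ := by group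
    rw [this]
    exact hQ.2 _ _ hab
  · change 1⁻¹ * k ∈ Q ↔ k ∈ Q
    simp

/-- The coefficients of an element of the integral group ring. -/
def groupRingCoeffHom (K : Type*) [Group K] : MonoidAlgebra ℤ K →+ (K → ℤ) where
  toFun f := f.coeff
  map_zero' := rfl
  map_add' _ _ := rfl

theorem groupRingCoeffHom_apply {K : Type*} [Group K] (f : MonoidAlgebra ℤ K) (k : K) :
    groupRingCoeffHom K f k = f.coeff k := rfl

section GroupRing

variable {K : Type*} [Group K] [LinearOrder K]

variable (K) in
/-- Elements of the integral group ring whose coefficient at the least element of the support is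
positive. -/
def groupRingCone : Set (MonoidAlgebra ℤ K) := groupRingCoeffHom K ⁻¹' lexCone {n | 0 < n}

theorem isAddCone_groupRingCone : IsAddCone (groupRingCone K) := by
  refine isAddCone_posInt.preimage_lexCone _ fun v hv => ?_
  have hne : v.coeff.support.Nonempty := by
    rwa [Finsupp.support_nonempty_iff, ne_eq, MonoidAlgebra.coeff_eq_zero]
  refine ⟨v.coeff.support.min' hne, fun i hi => ?_, ?_⟩
  · by_contra h
    exact absurd hi (not_lt.mpr (Finset.min'_le _ _ (Finsupp.mem_support_iff.mpr h)))
  · exact Finsupp.mem_support_iff.mp (Finset.min'_mem _ hne)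

theorem of_mem_mulStabilizer_groupRingCone [MulLeftStrictMono K] [MulRightStrictMono K] (k : K) :
    MonoidAlgebra.of ℤ K k ∈ mulStabilizer (groupRingCone K) := by
  rintro x ⟨n, hn, hn'⟩
  refine ⟨⟨k * n, fun i hi => ?_, ?_⟩, ⟨n * k, fun i hi => ?_, ?_⟩⟩
  · have := hn (k⁻¹ * i) (by simpa using mul_lt_mul_right hi k⁻¹)
    simpa [groupRingCoeffHom_apply] using this
  · simpa [groupRingCoeffHom_apply] using hn'
  · have := hn (i * k⁻¹) (by simpa using mul_lt_mul_left hi k⁻¹)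
    simpa [groupRingCoeffHom_apply] using this
  · simpa [groupRingCoeffHom_apply] using hn'

theorem one_sub_of_mem_groupRingCone {k : K} (hk : 1 < k) :
    1 - MonoidAlgebra.of ℤ K k ∈ groupRingCone K := by
  refine ⟨1, fun i hi => ?_, ?_⟩
  · simp [groupRingCoeffHom_apply, MonoidAlgebra.one_def, hi.ne', (hi.trans hk).ne']
  · simp [groupRingCoeffHom_apply, MonoidAlgebra.one_def, hk.ne']

end GroupRing

section Matrix

variable {R : Type*} [Ring R] {C : Set R}

/-- The entries of a square matrix of size two, in lexicographic order of positions. -/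
def matrixEntryHom (R : Type*) [Ring R] :
    Matrix (Fin 2) (Fin 2) R →+ (Fin 2 ×ₗ Fin 2 → R) where
  toFun M p := M (ofLex p).1 (ofLex p).2
  map_zero' := rfl
  map_add' _ _ := rfl

theorem matrixEntryHom_apply (M : Matrix (Fin 2) (Fin 2) R) (p : Fin 2 ×ₗ Fin 2) :
    matrixEntryHom R M p = M (ofLex p).1 (ofLex p).2 := rfl

/-- Matrices whose first nonzero entry lies in `C`. -/
def matrixCone (C : Set R) : Set (Matrix (Fin 2) (Fin 2) R) := matrixEntryHom R ⁻¹' lexCone C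

theorem IsAddCone.matrixCone (hC : IsAddCone C) : IsAddCone (matrixCone C) := by
  refine hC.preimage_lexCone _ fun v hv => ?_
  have hne : {p | matrixEntryHom R v p ≠ 0}.Nonempty := by
    by_contra h
    refine hv (Matrix.ext fun i j => ?_)
    by_contra h'
    exact h ⟨toLex (i, j), h'⟩
  refine ⟨wellFounded_lt.min _ hne, fun i hi => ?_, wellFounded_lt.min_mem _ hne⟩
  by_contra h
  exact wellFounded_lt.not_lt_min _ h hi

theorem diagonal_mem_mulStabilizer_matrixCone {d : Fin 2 → R}
    (hd : ∀ i, d i ∈ mulStabilizer C) :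
    Matrix.diagonal d ∈ mulStabilizer (matrixCone C) := by
  rintro x ⟨n, hn, hn'⟩
  refine ⟨⟨n, fun i hi => ?_, ?_⟩, ⟨n, fun i hi => ?_, ?_⟩⟩
  · have := hn i hi
    rw [matrixEntryHom_apply] at this
    simp [matrixEntryHom_apply, this]
  · simpa [matrixEntryHom_apply] using (hd _ _ hn').1
  · have := hn i hi
    rw [matrixEntryHom_apply] at this
    simp [matrixEntryHom_apply, this]
  · simpa [matrixEntryHom_apply] using (hd _ _ hn').2

end Matrix

section Polynomial

open Polynomial

variable {A : Type*} [Ring A] {S : Set A}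

/-- The coefficients of a polynomial. -/
def polynomialCoeffHom (A : Type*) [Ring A] : A[X] →+ (ℕ → A) where
  toFun p := p.coeff
  map_zero' := by ext; simp
  map_add' _ _ := by ext; simp

/-- Polynomials whose lowest nonzero coefficient lies in `S`. -/
def polynomialCone (S : Set A) : Set A[X] := polynomialCoeffHom A ⁻¹' lexCone S

theorem IsAddCone.polynomialCone (hS : IsAddCone S) : IsAddCone (polynomialCone S) := by
  refine hS.preimage_lexCone _ fun v hv => ⟨v.natTrailingDegree, fun i hi => ?_, ?_⟩
  · exact coeff_eq_zero_of_lt_natTrailingDegree hi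
  · exact trailingCoeff_nonzero_iff_nonzero.mpr hv

theorem mem_mulStabilizer_polynomialCone {p : A[X]} (hp : p.coeff 0 ∈ mulStabilizer S) :
    p ∈ mulStabilizer (polynomialCone S) := by
  rintro x ⟨n, hn, hn'⟩
  change ∀ i < n, x.coeff i = 0 at hn
  have hl (i : ℕ) (hi : i ≤ n) : (p * x).coeff i = p.coeff 0 * x.coeff i := by
    rw [coeff_mul, Finset.sum_eq_single_of_mem (0, i) (by simp)]
    rintro ⟨a, b⟩ hab hne
    rw [Finset.HasAntidiagonal.mem_antidiagonal] at hab
    have : b < i := by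
      by_contra h
      exact hne (Prod.ext (by simp only at *; omega) (by simp only at *; omega))
    rw [hn b (by omega), mul_zero]
  have hr (i : ℕ) (hi : i ≤ n) : (x * p).coeff i = x.coeff i * p.coeff 0 := by
    rw [coeff_mul, Finset.sum_eq_single_of_mem (i, 0) (by simp)]
    rintro ⟨b, a⟩ hab hne
    rw [Finset.HasAntidiagonal.mem_antidiagonal] at hab
    have : b < i := by
      by_contra h
      exact hne (Prod.ext (by simp only at *; omega) (by simp only at *; omega))
    rw [hn b (by omega), zero_mul]
  refine ⟨⟨n, fun i hi => ?_, ?_⟩, ⟨n, fun i hi => ?_, ?_⟩⟩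
  · change (p * x).coeff i = 0
    rw [hl i hi.le, hn i hi, mul_zero]
  · change (p * x).coeff n ∈ S
    rw [hl n le_rfl]
    exact (hp _ hn').1
  · change (x * p).coeff i = 0
    rw [hr i hi.le, hn i hi, zero_mul]
  · change (x * p).coeff n ∈ S
    rw [hr n le_rfl]
    exact (hp _ hn').2

/-- The polynomial `a + b X`. -/
noncomputable def linearPoly (a b : A) : A[X] := C a + C b * X

theorem linearPoly_coeff_zero (a b : A) : (linearPoly a b).coeff 0 = a := by
  simp [linearPoly]

theorem linearPoly_coeff_one (a b : A) : (linearPoly a b).coeff 1 = b := by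
  simp [linearPoly, coeff_C]

theorem natDegree_linearPoly_le (a b : A) : (linearPoly a b).natDegree ≤ 1 := by
  rw [linearPoly]
  compute_degree

theorem linearPoly_mul (a b c d : A) (h : b * d = 0) :
    linearPoly a b * linearPoly c d = linearPoly (a * c) (a * d + b * c) := by
  have h1 : C b * X * (C d * X) = 0 := by
    rw [mul_assoc, ← mul_assoc X, X_mul_C, mul_assoc, ← mul_assoc, ← C_mul, h, C_0, zero_mul]
  have h2 : C b * X * C c = C b * C c * X := by rw [mul_assoc, X_mul_C, mul_assoc]
  simp only [linearPoly, add_mul, mul_add, h1, h2, C_add, C_mul, mul_assoc]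
  abel

end Polynomial

section Representation

open Polynomial

variable {G H R : Type*} [Group G] [Group H] [Ring R]

/-- The representation of `G` by upper triangular matrix polynomials attached to `α`. -/
noncomputable def upperRep (α : G →* R) : G →* (Matrix (Fin 2) (Fin 2) R)[X] where
  toFun g := linearPoly (Matrix.diagonal ![α g, 1]) !![0, α g - 1; 0, 0]
  map_one' := by
    have : !![0, α 1 - 1; 0, 0] = (0 : Matrix (Fin 2) (Fin 2) R) := by
      ext i j; fin_cases i <;> fin_cases j <;> simp
    have h2 : Matrix.diagonal ![α 1, 1] = (1 : Matrix (Fin 2) (Fin 2) R) := by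
      ext i j; fin_cases i <;> fin_cases j <;> simp
    rw [this, h2]
    simp [linearPoly]
  map_mul' g h := by
    rw [linearPoly_mul]
    · congr 1
      · ext i j; fin_cases i <;> fin_cases j <;> simp
      · ext i j; fin_cases i <;> fin_cases j <;> simp [Matrix.mul_apply, -Matrix.cons_mul, mul_sub]
    · ext i j; fin_cases i <;> fin_cases j <;> simp [Matrix.mul_apply]

/-- The representation of `H` by lower triangular matrix polynomials attached to `β`. -/
noncomputable def lowerRep (β : H →* R) : H →* (Matrix (Fin 2) (Fin 2) R)[X] where
  toFun h := linearPoly (Matrix.diagonal ![1, β h]) !![0, 0; β h - 1, 0]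
  map_one' := by
    have : !![0, 0; β 1 - 1, 0] = (0 : Matrix (Fin 2) (Fin 2) R) := by
      ext i j; fin_cases i <;> fin_cases j <;> simp
    have h2 : Matrix.diagonal ![1, β 1] = (1 : Matrix (Fin 2) (Fin 2) R) := by
      ext i j; fin_cases i <;> fin_cases j <;> simp
    rw [this, h2]
    simp [linearPoly]
  map_mul' g h := by
    rw [linearPoly_mul]
    · congr 1
      · ext i j; fin_cases i <;> fin_cases j <;> simp
      · ext i j; fin_cases i <;> fin_cases j <;> simp [Matrix.mul_apply, -Matrix.cons_mul, mul_sub]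
    · ext i j; fin_cases i <;> fin_cases j <;> simp [Matrix.mul_apply]

theorem one_sub_linearPoly_mem_polynomialCone {A : Type*} [Ring A] {S : Set A} {a b : A}
    (h : 1 - a ∈ S) : 1 - linearPoly a b ∈ polynomialCone S := by
  refine ⟨0, fun i hi => absurd hi (Nat.not_lt_zero i), ?_⟩
  change (1 - linearPoly a b).coeff 0 ∈ S
  rwa [coeff_sub, linearPoly_coeff_zero, coeff_one_zero]

theorem one_sub_upperRep_mem {C : Set R} {α : G →* R} {g : G} (h : 1 - α g ∈ C) :
    1 - upperRep α g ∈ polynomialCone (matrixCone C) := by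
  refine one_sub_linearPoly_mem_polynomialCone ⟨toLex (0, 0), fun i hi => ?_, ?_⟩
  · exact absurd hi (not_lt.mpr (by revert i; decide))
  · simpa [matrixEntryHom_apply] using h

theorem one_sub_lowerRep_mem {C : Set R} {β : H →* R} {h : H} (hh : 1 - β h ∈ C) :
    1 - lowerRep β h ∈ polynomialCone (matrixCone C) := by
  refine one_sub_linearPoly_mem_polynomialCone ⟨toLex (1, 1), fun i hi => ?_, ?_⟩
  · obtain ⟨⟨a, b⟩, rfl⟩ := toLex.surjective i
    revert hi
    rw [matrixEntryHom_apply]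
    fin_cases a <;> fin_cases b <;> simp
  · simpa [matrixEntryHom_apply] using hh

/-- Reduced alternating products. A nonempty product with flag `false` begins with a letter of `G`,
one with flag `true` begins with a letter of `H`; the empty product carries both flags. -/
inductive IsReducedProd : Bool → Monoid.Coprod G H → Prop
  | one (b : Bool) : IsReducedProd b 1
  | inl_mul (g : G) (x : Monoid.Coprod G H) : g ≠ 1 → IsReducedProd true x →
      IsReducedProd false (Monoid.Coprod.inl g * x)
  | inr_mul (h : H) (x : Monoid.Coprod G H) : h ≠ 1 → IsReducedProd false x →
      IsReducedProd true (Monoid.Coprod.inr h * x)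

theorem exists_isReducedProd (x : Monoid.Coprod G H) : ∃ b, IsReducedProd b x := by
  induction x using Monoid.Coprod.induction_on' with
  | one => exact ⟨true, .one true⟩
  | inl_mul g x ih =>
    have key (k : G) (y : Monoid.Coprod G H) (hy : IsReducedProd true y) :
        ∃ b, IsReducedProd b (Monoid.Coprod.inl k * y) := by
      by_cases hk : k = 1
      · exact ⟨true, by simpa [hk] using hy⟩
      · exact ⟨false, .inl_mul k y hk hy⟩
    obtain ⟨b, hb⟩ := ih
    cases hb with
    | one => exact key g 1 (.one true)
    | inl_mul k y hk hy => simpa [mul_assoc] using key (g * k) y hy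
    | inr_mul h y hh hy => exact key g _ (.inr_mul h y hh hy)
  | inr_mul h x ih =>
    have key (k : H) (y : Monoid.Coprod G H) (hy : IsReducedProd false y) :
        ∃ b, IsReducedProd b (Monoid.Coprod.inr k * y) := by
      by_cases hk : k = 1
      · exact ⟨false, by simpa [hk] using hy⟩
      · exact ⟨true, .inr_mul k y hk hy⟩
    obtain ⟨b, hb⟩ := ih
    cases hb with
    | one => exact key h 1 (.one false)
    | inl_mul k y hk hy => exact key h _ (.inl_mul k y hk hy)
    | inr_mul k y hk hy => simpa [mul_assoc] using key (h * k) y hy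

variable {α : G →* R} {β : H →* R}

/-- The representation of the free product by matrix polynomials attached to `α` and `β`. -/
noncomputable def coprodRep (α : G →* R) (β : H →* R) :
    Monoid.Coprod G H →* (Matrix (Fin 2) (Fin 2) R)[X] :=
  Monoid.Coprod.lift (upperRep α) (lowerRep β)

theorem IsReducedProd.exists_coeff_ne_zero [Nontrivial R] [NoZeroDivisors R]
    (hα : ∀ g, α g = 1 → g = 1) (hβ : ∀ h, β h = 1 → h = 1) {b : Bool} {x : Monoid.Coprod G H}
    (hx : IsReducedProd b x) :
    ∃ n j, (coprodRep α β x).natDegree ≤ n ∧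
      (coprodRep α β x).coeff n (bif b then 1 else 0) j ≠ 0 ∧ (n = 0 → x = 1) := by
  induction hx with
  | one b => exact ⟨0, bif b then 1 else 0, by simp, by simp, fun _ => rfl⟩
  | inl_mul g x hg _ ih =>
    obtain ⟨n, j, hn, hj, -⟩ := ih
    have hd := natDegree_linearPoly_le (Matrix.diagonal ![α g, 1]) !![0, α g - 1; 0, 0]
    have he : coprodRep α β (Monoid.Coprod.inl g * x) =
      linearPoly (Matrix.diagonal ![α g, 1]) !![0, α g - 1; 0, 0] * coprodRep α β x := by
      rw [map_mul, coprodRep, Monoid.Coprod.lift_apply_inl]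
      rfl
    refine ⟨1 + n, j, ?_, ?_, by omega⟩
    · rw [he]
      exact natDegree_mul_le_of_le hd hn
    · rw [he, coeff_mul_add_eq_of_natDegree_le hd hn, linearPoly_coeff_one]
      have : α g - 1 ≠ 0 := fun h => hg (hα g (sub_eq_zero.mp h))
      simpa [Matrix.mul_apply, this] using hj
  | inr_mul h x hh _ ih =>
    obtain ⟨n, j, hn, hj, -⟩ := ih
    have hd := natDegree_linearPoly_le (Matrix.diagonal ![1, β h]) !![0, 0; β h - 1, 0]
    have he : coprodRep α β (Monoid.Coprod.inr h * x) =
      linearPoly (Matrix.diagonal ![1, β h]) !![0, 0; β h - 1, 0] * coprodRep α β x := by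
      rw [map_mul, coprodRep, Monoid.Coprod.lift_apply_inr]
      rfl
    refine ⟨1 + n, j, ?_, ?_, by omega⟩
    · rw [he]
      exact natDegree_mul_le_of_le hd hn
    · rw [he, coeff_mul_add_eq_of_natDegree_le hd hn, linearPoly_coeff_one]
      have : β h - 1 ≠ 0 := fun e => hh (hβ h (sub_eq_zero.mp e))
      simpa [Matrix.mul_apply, this] using hj

theorem eq_one_of_coprodRep_eq_one [Nontrivial R] [NoZeroDivisors R]
    (hα : ∀ g, α g = 1 → g = 1) (hβ : ∀ h, β h = 1 → h = 1) (x : Monoid.Coprod G H)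
    (hx : coprodRep α β x = 1) : x = 1 := by
  obtain ⟨b, hb⟩ := exists_isReducedProd x
  obtain ⟨n, j, -, hj, hn⟩ := hb.exists_coeff_ne_zero hα hβ
  refine hn ?_
  by_contra h
  simp [hx, coeff_one, h] at hj

theorem coprodRep_mem_mulStabilizer {C : Set R} (hα : ∀ g, α g ∈ mulStabilizer C)
    (hβ : ∀ h, β h ∈ mulStabilizer C) (x : Monoid.Coprod G H) :
    coprodRep α β x ∈ mulStabilizer (polynomialCone (matrixCone C)) := by
  induction x using Monoid.Coprod.induction_on with
  | inl g =>
    rw [coprodRep, Monoid.Coprod.lift_apply_inl]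
    refine mem_mulStabilizer_polynomialCone ?_
    change (linearPoly _ _).coeff 0 ∈ _
    rw [linearPoly_coeff_zero]
    refine diagonal_mem_mulStabilizer_matrixCone fun i => ?_
    fin_cases i
    exacts [hα g, one_mem _]
  | inr h =>
    rw [coprodRep, Monoid.Coprod.lift_apply_inr]
    refine mem_mulStabilizer_polynomialCone ?_
    change (linearPoly _ _).coeff 0 ∈ _
    rw [linearPoly_coeff_zero]
    refine diagonal_mem_mulStabilizer_matrixCone fun i => ?_
    fin_cases i
    exacts [one_mem _, hβ h]
  | mul x y hx hy =>
    rw [map_mul]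
    exact mul_mem hx hy

end Representation

/-- The free product of two bi-orderable groups is bi-orderable, by an order
extending the given bi-invariant orders on the two factors. -/
theorem coprod_bi_orderable (G₁ G₂ : Type*) [Group G₁] [Group G₂]
    (P₁ : Set G₁) (P₂ : Set G₂) (h₁ : IsBiPosCone P₁) (h₂ : IsBiPosCone P₂) :
    ∃ P : Set (Monoid.Coprod G₁ G₂), IsBiPosCone P ∧
      (∀ g : G₁, Monoid.Coprod.inl g ∈ P ↔ g ∈ P₁) ∧
      (∀ g : G₂, Monoid.Coprod.inr g ∈ P ↔ g ∈ P₂) := by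
  obtain ⟨_, _, _, hlt⟩ := (h₁.prod h₂).exists_linearOrder
  let α : G₁ →* MonoidAlgebra ℤ (G₁ × G₂) := (MonoidAlgebra.of ℤ _).comp (MonoidHom.inl G₁ G₂)
  let β : G₂ →* MonoidAlgebra ℤ (G₁ × G₂) := (MonoidAlgebra.of ℤ _).comp (MonoidHom.inr G₁ G₂)
  have hof (k : G₁ × G₂) (hk : MonoidAlgebra.of ℤ (G₁ × G₂) k = 1) : k = 1 :=
    MonoidAlgebra.of_injective (hk.trans (map_one _).symm)
  have hα (g : G₁) (hg : α g = 1) : g = 1 := congrArg Prod.fst (hof _ hg)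
  have hβ (g : G₂) (hg : β g = 1) : g = 1 := congrArg Prod.snd (hof _ hg)
  have hP := (isAddCone_groupRingCone (K := G₁ × G₂)).matrixCone.polynomialCone.isBiPosCone
    (coprodRep α β)
    (coprodRep_mem_mulStabilizer (fun _ => of_mem_mulStabilizer_groupRingCone _)
      fun _ => of_mem_mulStabilizer_groupRingCone _)
    (eq_one_of_coprodRep_eq_one hα hβ)
  refine ⟨_, hP, h₁.1.mem_iff_of_map hP.1 _ fun g hg => ?_,
    h₂.1.mem_iff_of_map hP.1 _ fun g hg => ?_⟩
  · rw [Set.mem_ofPred_eq, coprodRep, Monoid.Coprod.lift_apply_inl]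
    exact one_sub_upperRep_mem (one_sub_of_mem_groupRingCone ((hlt _).mpr (Or.inl hg)))
  · rw [Set.mem_ofPred_eq, coprodRep, Monoid.Coprod.lift_apply_inr]
    exact one_sub_lowerRep_mem (one_sub_of_mem_groupRingCone ((hlt _).mpr (Or.inr ⟨rfl, hg⟩)))
end

section
/- Every free group is bi-orderable; in particular, the free group F₂ on two generators admits a bi-invariant linear order. -/
namespace Magnus

variable {α : Type*}

/-- The product of two noncommutative formal power series, given by their coefficients. -/
def conv : (List α → ℤ) → (List α → ℤ) → List α → ℤ
  | f, h, [] => f [] * h []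
  | f, h, a :: w => f [] * h (a :: w) + conv (fun u => f (a :: u)) h w

/-- The power series `1`. -/
def unit : List α → ℤ
  | [] => 1
  | _ :: _ => 0

lemma conv_zero_left (h : List α → ℤ) (w : List α) : conv (fun _ => 0) h w = 0 := by
  induction w with
  | nil => simp [conv]
  | cons a w ih => simp [conv, ih]

lemma conv_add_left (f f' h : List α → ℤ) (w : List α) :
    conv (fun u => f u + f' u) h w = conv f h w + conv f' h w := by
  induction w generalizing f f' with
  | nil => simp [conv, add_mul]
  | cons a w ih => simp only [conv, ih]; ring

lemma conv_unit_left (h : List α → ℤ) : conv unit h = h := by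
  funext w
  cases w with
  | nil => simp [conv, unit]
  | cons a w => simp [conv, unit, conv_zero_left]

/-- If `f` has no terms of degree less than that of `w`, only the constant term of `h` matters. -/
lemma conv_of_left_eq_zero {f h : List α → ℤ} {w : List α} (h0 : h [] = 1)
    (hf : ∀ u : List α, u.length < w.length → f u = 0) : conv f h w = f w := by
  induction w generalizing f with
  | nil => simp [conv, h0]
  | cons a w ih =>
    rw [conv, hf [] (by simp), ih fun u hu => hf _ (by simpa using hu)]
    simp

lemma conv_eq_add_of_left {f h : List α → ℤ} {w : List α} (hw : w ≠ []) (f0 : f [] = 1)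
    (h0 : h [] = 1) (hf : ∀ u : List α, u ≠ [] → u.length < w.length → f u = 0) :
    conv f h w = f w + h w := by
  cases w with
  | nil => exact absurd rfl hw
  | cons a w =>
    rw [conv, f0, conv_of_left_eq_zero h0 fun u hu => hf _ (by simp) (by simpa using hu)]
    ring

lemma conv_of_right_eq_zero {f h : List α → ℤ} {w : List α} (hw : w ≠ [])
    (h0 : h [] = 1) (hh : ∀ u : List α, u ≠ [] → u.length < w.length → h u = 0) :
    conv f h w = f w + f [] * h w := by
  induction w generalizing f with
  | nil => exact absurd rfl hw
  | cons a w ih =>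
    rw [conv]
    rcases eq_or_ne w [] with rfl | hne
    · simp [conv, h0, add_comm]
    · rw [ih hne fun u hu hl => hh u hu (by simp; lia), hh w hne (by simp)]
      ring

lemma head_ne_of_chain {a : α} {w : List α} (h : (a :: w).IsChain (· ≠ ·)) :
    w.head? ≠ some a := by
  cases w with
  | nil => simp
  | cons b w => simpa using (List.isChain_cons_cons.1 h).1.symm

variable [DecidableEq α]

/-- Left multiplication by the series `1 + a`. -/
def genMul (a : α) (f : List α → ℤ) : List α → ℤ
  | [] => f []
  | b :: w => f (b :: w) + if a = b then f w else 0

/-- Left multiplication by the series `(1 + a)⁻¹`. -/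
def genMulInv (a : α) (f : List α → ℤ) : List α → ℤ
  | [] => f []
  | b :: w => f (b :: w) - if a = b then genMulInv a f w else 0

/-- Left multiplication by the series `1 + a`, as a permutation. -/
def gen (a : α) : Equiv.Perm (List α → ℤ) where
  toFun := genMul a
  invFun := genMulInv a
  left_inv f := by
    funext w
    induction w with
    | nil => rfl
    | cons b w ih => simp [genMulInv, genMul, ih]
  right_inv f := by
    funext w
    cases w <;> simp [genMulInv, genMul]

lemma gen_conv (a : α) (f h : List α → ℤ) : gen a (conv f h) = conv (gen a f) h := by
  funext w
  cases w with
  | nil => rfl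
  | cons b w =>
    change conv f h (b :: w) + (if a = b then conv f h w else 0) =
      f [] * h (b :: w) + conv (fun u => f (b :: u) + if a = b then f u else 0) h w
    rw [conv_add_left, conv]
    split_ifs
    · ring
    · rw [conv_zero_left]; ring

/-- The action of the free group on power series given by the Magnus embedding `a ↦ 1 + a`. -/
def action : FreeGroup α →* Equiv.Perm (List α → ℤ) := FreeGroup.lift gen

lemma action_conv (g : FreeGroup α) (f h : List α → ℤ) :
    action g (conv f h) = conv (action g f) h := by
  induction g using FreeGroup.induction_on generalizing f with
  | C1 => simp
  | of a => simpa [action] using gen_conv a f h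
  | inv_of a ih =>
    rw [map_inv, Equiv.Perm.inv_eq_iff_eq, ih]
    simp
  | mul x y hx hy => simp [hx, hy]

/-- The coefficients of the Magnus expansion of `g`. -/
def coeff (g : FreeGroup α) : List α → ℤ := action g unit

lemma coeff_one : coeff (1 : FreeGroup α) = unit := by simp [coeff]

lemma coeff_mul (g h : FreeGroup α) : coeff (g * h) = conv (coeff g) (coeff h) := by
  simp [coeff, ← action_conv, conv_unit_left]

lemma action_nil (g : FreeGroup α) (f : List α → ℤ) : action g f [] = f [] := by
  induction g using FreeGroup.induction_on generalizing f with
  | C1 => simp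
  | of a => simp [action, gen, genMul]
  | inv_of a ih => simpa using (ih ((action (FreeGroup.of a))⁻¹ f)).symm
  | mul x y hx hy => simp [hx, hy]

lemma coeff_nil (g : FreeGroup α) : coeff g [] = 1 := action_nil g unit

/-- The action of a letter or its inverse. -/
def letter (x : α × Bool) : Equiv.Perm (List α → ℤ) := cond x.2 (gen x.1) (gen x.1)⁻¹

/-- The exponent of a letter. -/
def sgn (s : Bool) : ℤ := cond s 1 (-1)

lemma letter_of_head_ne (x : α × Bool) (f : List α → ℤ) {w : List α} (hw : w.head? ≠ some x.1) :
    letter x f w = f w := by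
  obtain ⟨a, s⟩ := x
  cases w with
  | nil => cases s <;> rfl
  | cons b w =>
    have : a ≠ b := by rintro rfl; simp at hw
    cases s
    · change f (b :: w) - (if a = b then _ else 0) = _
      simp [this]
    · change f (b :: w) + (if a = b then _ else 0) = _
      simp [this]

lemma letter_cons (x : α × Bool) (f : List α → ℤ) {w : List α} (hw : w.head? ≠ some x.1) :
    letter x f (x.1 :: w) = f (x.1 :: w) + sgn x.2 * f w := by
  have h := letter_of_head_ne x f hw
  obtain ⟨a, s⟩ := x
  cases s
  · change f (a :: w) - (if a = a then letter (a, false) f w else 0) = _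
    rw [h]
    simp [sgn, sub_eq_add_neg]
  · change f (a :: w) + (if a = a then f w else 0) = _
    simp [sgn]

lemma sgn_mul_self (s : Bool) : sgn s * sgn s = 1 := by cases s <;> rfl

/-- Among the words without equal adjacent letters, `x.1 :: w` is longest in the support of `f`,
every other word of that length in the support also starts with `x.1`, and the coefficients of
`x.1 :: w` and `w` are nonzero with relative sign that of the exponent of `x`. -/
structure Leads (x : α × Bool) (w : List α) (f : List α → ℤ) : Prop where
  chain : (x.1 :: w).IsChain (· ≠ ·)
  pos : 0 < sgn x.2 * (f (x.1 :: w) * f w)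
  vanish : ∀ v : List α, v.IsChain (· ≠ ·) → w.length < v.length →
    (v.head? = some x.1 → w.length + 1 < v.length) → f v = 0

/-- Acting by a letter raises the length bound on the support by at most one, and only on words
starting with that letter. -/
lemma letter_vanish {x : α × Bool} {f : List α → ℤ} {n : ℕ}
    (hlong : ∀ v : List α, v.IsChain (· ≠ ·) → v.head? ≠ some x.1 → n < v.length → f v = 0)
    (hhead : ∀ v : List α, v.IsChain (· ≠ ·) → n + 1 < v.length → f v = 0)
    (v : List α) (hv : v.IsChain (· ≠ ·)) (hl : n < v.length)
    (hx : v.head? = some x.1 → n + 1 < v.length) : letter x f v = 0 := by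
  by_cases h : v.head? = some x.1
  · obtain ⟨u, rfl⟩ : ∃ u, v = x.1 :: u := by
      cases v with
      | nil => simp at h
      | cons b u => exact ⟨u, by simpa using h⟩
    have hu := head_ne_of_chain hv
    have hn : n < u.length := by simpa using hx h
    rw [letter_cons x f hu, hhead _ hv (hx h), hlong u hv.tail hu hn]
    simp
  · rw [letter_of_head_ne x f h, hlong v hv h hl]

lemma Leads.same {x : α × Bool} {w : List α} {f : List α → ℤ} (h : Leads x w f) :
    Leads x w (letter x f) where
  chain := h.chain
  pos := by
    have hw := head_ne_of_chain h.chain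
    rw [letter_cons x f hw, letter_of_head_ne x f hw]
    nlinarith [h.pos, sgn_mul_self x.2, mul_self_nonneg (f w)]
  vanish := letter_vanish (fun v hv hx hl => h.vanish v hv hl fun e => absurd e hx)
    fun v hv hl => h.vanish v hv (by lia) fun _ => hl

lemma Leads.cons {x y : α × Bool} {w : List α} {f : List α → ℤ} (h : Leads x w f)
    (hxy : y.1 ≠ x.1) : Leads y (x.1 :: w) (letter y f) where
  chain := List.isChain_cons_cons.2 ⟨hxy, h.chain⟩
  pos := by
    have hw : (x.1 :: w).head? ≠ some y.1 := by simpa using hxy.symm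
    have hne : f (x.1 :: w) ≠ 0 := by
      intro e
      simpa [e] using h.pos
    rw [letter_cons y f hw, letter_of_head_ne y f hw, h.vanish (y.1 :: x.1 :: w)
      (List.isChain_cons_cons.2 ⟨hxy, h.chain⟩) (by simp) (by simp)]
    have := sgn_mul_self y.2
    calc 0 < f (x.1 :: w) * f (x.1 :: w) := mul_self_pos.2 hne
      _ = _ := by linear_combination (-(f (x.1 :: w) * f (x.1 :: w))) * this
  vanish := by
    refine letter_vanish (fun v hv _ hl => ?_) fun v hv hl => ?_ <;>
    · simp only [List.length_cons] at hl
      exact h.vanish v hv (by lia) fun _ => by lia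

lemma exists_leads {x : α × Bool} {L : List (α × Bool)} (hL : FreeGroup.IsReduced (x :: L)) :
    ∃ w, Leads x w (coeff (FreeGroup.mk (x :: L))) := by
  have step (x : α × Bool) (L : List (α × Bool)) :
      coeff (FreeGroup.mk (x :: L)) = letter x (coeff (FreeGroup.mk L)) := by
    simp [coeff, action, letter, FreeGroup.lift_mk]
  induction L generalizing x with
  | nil =>
    rw [step, ← FreeGroup.one_eq_mk, coeff_one]
    refine ⟨[], List.isChain_singleton _, ?_, letter_vanish ?_ ?_⟩
    · rw [letter_cons _ _ (by simp), letter_of_head_ne _ _ (by simp)]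
      simp [unit, sgn_mul_self]
    all_goals
      intro v _
      cases v <;> simp [unit]
  | cons y L ih =>
    rw [FreeGroup.isReduced_cons_cons] at hL
    obtain ⟨w, hw⟩ := ih hL.2
    rw [step]
    by_cases h : x.1 = y.1
    · obtain rfl : x = y := Prod.ext h (hL.1 h)
      exact ⟨w, hw.same⟩
    · exact ⟨_, hw.cons h⟩

lemma exists_coeff_ne_zero {g : FreeGroup α} (hg : g ≠ 1) : ∃ w, w ≠ [] ∧ coeff g w ≠ 0 := by
  obtain ⟨x, L, hL⟩ := List.exists_cons_of_ne_nil (mt FreeGroup.toWord_eq_nil_iff.1 hg)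
  obtain ⟨w, hw⟩ := exists_leads (hL ▸ FreeGroup.isReduced_toWord (x := g))
  rw [← hL, FreeGroup.mk_toWord] at hw
  refine ⟨x.1 :: w, by simp, fun e => ?_⟩
  simpa [e] using hw.pos

/-- The leading coefficient of `g - 1` is positive. -/
def positiveCone [LT (List α)] : Set (FreeGroup α) :=
  {g | ∃ m, m ≠ [] ∧ 0 < coeff g m ∧ ∀ v, v ≠ [] → v < m → coeff g v = 0}

section Order

variable [LinearOrder (List α)] {g h p : FreeGroup α} {m v : List α}

lemma coeff_mul_of_left (hlen : ∀ u v : List α, u.length < v.length → u < v)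
    (hg : ∀ v, v ≠ [] → v < m → coeff g v = 0) (hv : v ≠ []) (hvm : v ≤ m) :
    coeff (g * h) v = coeff g v + coeff h v := by
  rw [coeff_mul]
  exact conv_eq_add_of_left hv (coeff_nil g) (coeff_nil h) fun u hu hl =>
    hg u hu ((hlen u v hl).trans_le hvm)

lemma coeff_mul_of_right (hlen : ∀ u v : List α, u.length < v.length → u < v)
    (hh : ∀ v, v ≠ [] → v < m → coeff h v = 0) (hv : v ≠ []) (hvm : v ≤ m) :
    coeff (g * h) v = coeff g v + coeff h v := by
  rw [coeff_mul, conv_of_right_eq_zero hv (coeff_nil h) fun u hu hl =>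
    hh u hu ((hlen u v hl).trans_le hvm), coeff_nil, one_mul]

lemma coeff_inv (hlen : ∀ u v : List α, u.length < v.length → u < v)
    (hg : ∀ v, v ≠ [] → v < m → coeff g v = 0) (hv : v ≠ []) (hvm : v ≤ m) :
    coeff g⁻¹ v = -coeff g v := by
  have key := coeff_mul_of_left (h := g⁻¹) hlen hg hv hvm
  rw [mul_inv_cancel, coeff_one] at key
  cases v with
  | nil => exact absurd rfl hv
  | cons a v =>
    simp only [unit] at key
    lia

lemma coeff_conj [WellFoundedLT (List α)] (hlen : ∀ u v : List α, u.length < v.length → u < v)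
    (hp : ∀ v, v ≠ [] → v < m → coeff p v = 0) (hv : v ≠ []) (hvm : v ≤ m) :
    coeff (g * p * g⁻¹) v = coeff p v := by
  induction v using WellFoundedLT.induction with
  | ind v ih =>
    have hq : ∀ u, u ≠ [] → u < v → coeff (g * p * g⁻¹) u = 0 := fun u hu huv => by
      rw [ih u huv hu (huv.le.trans hvm), hp u hu (huv.trans_le hvm)]
    have key := coeff_mul_of_left (h := g) hlen hq hv le_rfl
    rw [inv_mul_cancel_right, coeff_mul_of_right hlen hp hv hvm] at key
    lia

lemma mul_mem_positiveCone (hlen : ∀ u v : List α, u.length < v.length → u < v)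
    (hg : g ∈ positiveCone) (hh : h ∈ positiveCone) : g * h ∈ positiveCone := by
  obtain ⟨m, hm, gpos, gz⟩ := hg
  obtain ⟨n, hn, hpos, hz⟩ := hh
  rcases le_total m n with hmn | hnm
  · refine ⟨m, hm, ?_, fun v hv hvm => ?_⟩
    · rw [coeff_mul_of_left hlen gz hm le_rfl]
      rcases hmn.eq_or_lt with rfl | hlt
      · exact add_pos gpos hpos
      · simpa [hz m hm hlt] using gpos
    · rw [coeff_mul_of_left hlen gz hv hvm.le, gz v hv hvm, hz v hv (hvm.trans_le hmn), add_zero]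
  · refine ⟨n, hn, ?_, fun v hv hvn => ?_⟩
    · rw [coeff_mul_of_right hlen hz hn le_rfl]
      rcases hnm.eq_or_lt with rfl | hlt
      · exact add_pos gpos hpos
      · simpa [gz n hn hlt] using hpos
    · rw [coeff_mul_of_right hlen hz hv hvn.le, gz v hv (hvn.trans_le hnm), hz v hv hvn, add_zero]

lemma conj_mem_positiveCone [WellFoundedLT (List α)]
    (hlen : ∀ u v : List α, u.length < v.length → u < v) (g : FreeGroup α)
    (hp : p ∈ positiveCone) : g * p * g⁻¹ ∈ positiveCone := by
  obtain ⟨m, hm, pos, hz⟩ := hp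
  refine ⟨m, hm, ?_, fun v hv hvm => ?_⟩
  · rwa [coeff_conj hlen hz hm le_rfl]
  · rw [coeff_conj hlen hz hv hvm.le, hz v hv hvm]

lemma one_notMem_positiveCone : (1 : FreeGroup α) ∉ positiveCone := by
  rintro ⟨m, hm, pos, -⟩
  rw [coeff_one] at pos
  cases m with
  | nil => exact hm rfl
  | cons a m => simp [unit] at pos

lemma mem_or_inv_mem_positiveCone [WellFoundedLT (List α)]
    (hlen : ∀ u v : List α, u.length < v.length → u < v) (hg : g ≠ 1) :
    g ∈ positiveCone ∨ g⁻¹ ∈ positiveCone := by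
  obtain ⟨m, ⟨hm, hne⟩, hmin⟩ := wellFounded_lt.has_min {w | w ≠ [] ∧ coeff g w ≠ 0}
    (exists_coeff_ne_zero hg)
  have hz : ∀ v, v ≠ [] → v < m → coeff g v = 0 := fun v hv hvm => by
    by_contra e
    exact hmin v ⟨hv, e⟩ hvm
  rcases hne.lt_or_gt with hneg | hpos
  · refine Or.inr ⟨m, hm, ?_, fun v hv hvm => ?_⟩
    · rw [coeff_inv hlen hz hm le_rfl]
      lia
    · rw [coeff_inv hlen hz hv hvm.le, hz v hv hvm, neg_zero]
  · exact Or.inl ⟨m, hm, hpos, hz⟩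

theorem isBiPosCone_positiveCone [WellFoundedLT (List α)]
    (hlen : ∀ u v : List α, u.length < v.length → u < v) :
    IsBiPosCone (positiveCone (α := α)) := by
  refine ⟨⟨fun a ha b hb => mul_mem_positiveCone hlen ha hb, fun g => ?_⟩,
    fun g p hp => conj_mem_positiveCone hlen g hp⟩
  have not_both : g ∈ positiveCone → g⁻¹ ∉ positiveCone := fun h h' =>
    one_notMem_positiveCone (mul_inv_cancel g ▸ mul_mem_positiveCone hlen h h')
  by_cases hg : g = 1
  · subst hg
    simp [one_notMem_positiveCone]
  · have := mem_or_inv_mem_positiveCone hlen hg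
    tauto

end Order

end Magnus

theorem FreeGroup.exists_isBiPosCone (α : Type*) : ∃ P : Set (FreeGroup α), IsBiPosCone P := by
  classical
  let r : List α → List α → Prop := List.Shortlex WellOrderingRel
  have : IsWellOrder (List α) r := { wf := List.Shortlex.wf WellOrderingRel.isWellOrder.wf }
  let _ : LinearOrder (List α) := linearOrderOfSTO r
  have : WellFoundedLT (List α) := ⟨IsWellFounded.wf (r := r)⟩
  exact ⟨_, Magnus.isBiPosCone_positiveCone fun _ _ h => List.Shortlex.of_length_lt h⟩

/-- Every free group is bi-orderable; in particular the free group on two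
generators admits a bi-invariant positive cone (equivalently, a bi-invariant
linear order). -/
theorem free_group_bi_orderable :
    (∀ α : Type, ∃ P : Set (FreeGroup α), IsBiPosCone P) ∧
      ∃ P : Set (FreeGroup (Fin 2)), IsBiPosCone P := by
  exact ⟨fun α => FreeGroup.exists_isBiPosCone α, FreeGroup.exists_isBiPosCone (Fin 2)⟩
end

section
/- The space LO(F₂) of left-invariant positive cones of the free group F₂ on two generators has no isolated points. -/
/-- The space `LO(G)` of left-invariant positive cones of `G`, topologized as a
subspace of the product space `{0,1}^G` via characteristic functions. -/
abbrev LOSpace (G : Type*) [Group G] : Type _ :=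
  {f : G → Bool // IsPosCone {g | f g = true}}

/-- Every finite partial order isomorphism between countable dense linear orders without endpoints
extends to an order isomorphism. -/
theorem Order.PartialIso.exists_orderIso_extension {α β : Type*} [LinearOrder α] [LinearOrder β]
    [Countable α] [DenselyOrdered α] [NoMinOrder α] [NoMaxOrder α] [Nonempty α]
    [Countable β] [DenselyOrdered β] [NoMinOrder β] [NoMaxOrder β] [Nonempty β]
    (f₀ : Order.PartialIso α β) : ∃ e : α ≃o β, ∀ p ∈ f₀.val, e p.1 = p.2 := by
  cases nonempty_encodable α
  cases nonempty_encodable β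
  let toCofinal : α ⊕ β → Order.Cofinal (Order.PartialIso α β) := fun p ↦
    Sum.recOn p (definedAtLeft β) (definedAtRight α)
  let I : Order.Ideal (Order.PartialIso α β) := Order.idealOfCofinals f₀ toCofinal
  let F a := funOfIdeal a I (Order.cofinal_meets_idealOfCofinals _ toCofinal (Sum.inl a))
  let G b := invOfIdeal b I (Order.cofinal_meets_idealOfCofinals _ toCofinal (Sum.inr b))
  refine ⟨OrderIso.ofCmpEqCmp (fun a ↦ (F a).val) (fun b ↦ (G b).val) fun a b ↦ ?_, ?_⟩
  · rcases (F a).prop with ⟨f, hf, ha⟩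
    rcases (G b).prop with ⟨g, hg, hb⟩
    rcases I.directed _ hf _ hg with ⟨m, _, fm, gm⟩
    exact m.prop (a, _) (fm ha) (_, b) (gm hb)
  · rintro ⟨a, b⟩ hab
    change (F a).val = b
    rcases (F a).prop with ⟨f, hf, ha⟩
    rcases I.directed _ hf _ (Order.mem_idealOfCofinals f₀ toCofinal) with ⟨m, _, fm, gm⟩
    have h := m.prop _ (fm ha) _ (gm hab)
    rw [cmp_self_eq_eq] at h
    exact cmp_eq_eq_iff _ _ |>.1 h.symm

namespace IsPosCone

variable {G : Type*} [Group G] {P : Set G}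

theorem one_notMem (hP : IsPosCone P) : (1 : G) ∉ P := by
  have := hP.2 1
  simp only [inv_one] at this
  tauto

theorem inv_notMem (hP : IsPosCone P) {g : G} (hg : g ∈ P) : g⁻¹ ∉ P := by
  have := hP.2 g
  tauto

theorem mem_or_inv_mem (hP : IsPosCone P) {g : G} (hg : g ≠ 1) : g ∈ P ∨ g⁻¹ ∈ P := by
  have := hP.2 g
  tauto

theorem of_mul_mem (hmul : ∀ a ∈ P, ∀ b ∈ P, a * b ∈ P) (hone : (1 : G) ∉ P)
    (htotal : ∀ g ≠ 1, g ∈ P ∨ g⁻¹ ∈ P) : IsPosCone P := by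
  have hinv : ∀ g ∈ P, g⁻¹ ∉ P := fun g hg hg' ↦ hone (by simpa using hmul g hg _ hg')
  refine ⟨hmul, fun g ↦ ?_⟩
  rcases eq_or_ne g 1 with rfl | hg
  · simp [hone]
  · have := htotal g hg
    have := hinv g
    tauto

/-- The cone of the reverse order. -/
theorem inv (hP : IsPosCone P) : IsPosCone {g | g⁻¹ ∈ P} := by
  refine of_mul_mem (fun a ha b hb ↦ ?_) ?_ fun g hg ↦ ?_
  · simpa using hP.1 _ hb _ ha
  · simpa using hP.one_notMem
  · simpa using (hP.mem_or_inv_mem hg).symm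

/-- The left-invariant order of a positive cone on a countable group embeds into `ℚ`. -/
theorem exists_rat_embedding [Countable G] (hP : IsPosCone P) :
    ∃ φ : G → ℚ, ∀ x y, φ x < φ y ↔ x⁻¹ * y ∈ P := by
  classical
  let _ : LinearOrder G :=
    { le := fun x y ↦ x = y ∨ x⁻¹ * y ∈ P
      lt := fun x y ↦ x⁻¹ * y ∈ P
      le_refl := fun x ↦ Or.inl rfl
      le_trans := by
        rintro x y z (rfl | hxy) (rfl | hyz)
        · exact Or.inl rfl
        · exact Or.inr hyz
        · exact Or.inr hxy
        · exact Or.inr (by simpa [mul_assoc] using hP.1 _ hxy _ hyz)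
      lt_iff_le_not_ge := by
        intro x y
        constructor
        · refine fun h ↦ ⟨Or.inr h, ?_⟩
          rintro (rfl | h')
          · exact hP.one_notMem (by simpa using h)
          · exact hP.inv_notMem h (by simpa using h')
        · rintro ⟨rfl | h, h'⟩
          · exact absurd (Or.inl rfl) h'
          · exact h
      le_antisymm := by
        rintro x y (rfl | hxy) (h | hyx)
        · rfl
        · rfl
        · exact h.symm
        · exact absurd (by simpa using hyx) (hP.inv_notMem hxy)
      le_total := by
        intro x y
        rcases eq_or_ne x y with h | h
        · exact Or.inl (Or.inl h)
        · have h' : x⁻¹ * y ≠ 1 := fun e ↦ h (inv_mul_eq_one.1 e)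
          rcases hP.mem_or_inv_mem h' with h | h
          · exact Or.inl (Or.inr h)
          · exact Or.inr (Or.inr (by simpa using h))
      toDecidableLE := Classical.decRel _ }
  obtain ⟨φ⟩ := Order.embedding_from_countable_to_dense (α := G) (β := ℚ)
  exact ⟨φ, fun x y ↦ φ.lt_iff_lt⟩

/-- An order action with base point `x` induces a positive cone, once a positive cone is used to
order the stabilizer of `x`. -/
theorem of_orderAction {α : Type*} [LinearOrder α] (hP : IsPosCone P) (ρ : G →* (α ≃o α)) (x : α) :
    IsPosCone {g | x < ρ g x ∨ ρ g x = x ∧ g ∈ P} := by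
  have happly : ∀ a b : G, ρ (a * b) x = ρ a (ρ b x) := fun a b ↦ by rw [map_mul]; rfl
  have hinv : ∀ g : G, ρ g (ρ g⁻¹ x) = x := fun g ↦ by rw [← happly]; simp
  refine of_mul_mem ?_ ?_ fun g hg ↦ ?_
  · rintro a (ha | ⟨ha, ha'⟩) b (hb | ⟨hb, hb'⟩)
    · left
      rw [happly]
      exact ha.trans ((ρ a).lt_iff_lt.2 hb)
    · left
      rwa [happly, hb]
    · left
      rw [happly]
      exact ha.symm.trans_lt ((ρ a).lt_iff_lt.2 hb)
    · right
      exact ⟨by rw [happly, hb, ha], hP.1 _ ha' _ hb'⟩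
  · simp [hP.one_notMem]
  · rcases lt_trichotomy x (ρ g x) with h | h | h
    · exact Or.inl (Or.inl h)
    · have h' : ρ g⁻¹ x = x := (ρ g).injective ((hinv g).trans h)
      exact (hP.mem_or_inv_mem hg).imp (fun k ↦ Or.inr ⟨h.symm, k⟩) fun k ↦ Or.inr ⟨h', k⟩
    · exact Or.inr (Or.inl ((ρ g).lt_iff_lt.1 (by rwa [hinv])))

end IsPosCone

/-- If `t` moves the maximum `M` of a finite set `B` upwards, then left multiplication by `t` on
`B` extends to an automorphism of `ℚ` sending `M` to any prescribed larger point. -/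
theorem exists_orderIso_extending_mul_left {G : Type*} [Group G] {φ : G → ℚ}
    (hφ : ∀ g x y, φ (g * x) < φ (g * y) ↔ φ x < φ y) {B : Finset G} {M t : G}
    (hM : ∀ g ∈ B, φ g ≤ φ M) (ht : φ M < φ (t * M)) {q : ℚ} (hq : φ M < q) :
    ∃ e : ℚ ≃o ℚ, (∀ g ∈ B, t * g ∈ B → e (φ g) = φ (t * g)) ∧ e (φ M) = q := by
  classical
  let f : Finset (ℚ × ℚ) :=
    insert (φ M, q) ((B.filter fun g ↦ t * g ∈ B).image fun g ↦ (φ g, φ (t * g)))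
  have hlt : ∀ g ∈ B, t * g ∈ B → φ g < φ M := fun g _ hg' ↦
    (hφ t g M).1 ((hM _ hg').trans_lt ht)
  have hcmp : ∀ p ∈ f, ∀ r ∈ f, cmp p.1 r.1 = cmp p.2 r.2 := by
    intro p hp r hr
    simp only [f, Finset.mem_insert, Finset.mem_image, Finset.mem_filter] at hp hr
    rcases hp with rfl | ⟨g, ⟨hg, hg'⟩, rfl⟩ <;> rcases hr with rfl | ⟨k, ⟨hk, hk'⟩, rfl⟩
    · simp
    · rw [(cmp_eq_gt_iff _ _).2 (hlt k hk hk'), (cmp_eq_gt_iff _ _).2 ((hM _ hk').trans_lt hq)]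
    · rw [(cmp_eq_lt_iff _ _).2 (hlt g hg hg'), (cmp_eq_lt_iff _ _).2 ((hM _ hg').trans_lt hq)]
    · rcases lt_trichotomy (φ g) (φ k) with h | h | h
      · rw [(cmp_eq_lt_iff _ _).2 h, (cmp_eq_lt_iff _ _).2 ((hφ t g k).2 h)]
      · have h₁ := (hφ t g k).not.2 h.not_lt
        have h₂ := (hφ t k g).not.2 h.not_gt
        rw [(cmp_eq_eq_iff _ _).2 h, (cmp_eq_eq_iff _ _).2 (le_antisymm (not_lt.1 h₂) (not_lt.1 h₁))]
      · rw [(cmp_eq_gt_iff _ _).2 h, (cmp_eq_gt_iff _ _).2 ((hφ t k g).2 h)]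
  obtain ⟨e, he⟩ := Order.PartialIso.exists_orderIso_extension ⟨f, hcmp⟩
  refine ⟨e, fun g hg hg' ↦ he (φ g, φ (t * g)) ?_, he (φ M, q) (Finset.mem_insert_self _ _)⟩
  exact Finset.mem_insert_of_mem
    (Finset.mem_image_of_mem _ (Finset.mem_filter.2 ⟨hg, hg'⟩))

/-- Every finite subset of a free group lies in a finite set `B` containing `1` that is connected
in the Cayley graph: a map on `B` that is locally equivariant for the generators is an orbit map. -/
theorem FreeGroup.exists_finset_orbit_eq {α X : Type*} [DecidableEq α]
    (S : Finset (FreeGroup α)) :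
    ∃ B : Finset (FreeGroup α), S ⊆ B ∧ 1 ∈ B ∧
      ∀ (ρ : FreeGroup α →* Equiv.Perm X) (φ : FreeGroup α → X),
        (∀ i, ∀ g ∈ B, of i * g ∈ B → ρ (of i) (φ g) = φ (of i * g)) →
        ∀ g ∈ B, ρ g (φ 1) = φ g := by
  let B := ((insert 1 S).biUnion fun g ↦ g.toWord.tails.toFinset).image mk
  have hB : ∀ g, g ∈ B ↔ ∃ L, (∃ k ∈ insert 1 S, L <:+ k.toWord) ∧ mk L = g := by
    simp only [B, Finset.mem_image, Finset.mem_biUnion, List.mem_toFinset, List.mem_tails,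
      implies_true]
  have hS : insert 1 S ⊆ B := fun g hg ↦
    (hB g).2 ⟨g.toWord, ⟨g, hg, List.suffix_rfl⟩, mk_toWord⟩
  refine ⟨B, fun g hg ↦ hS (Finset.mem_insert_of_mem hg), hS (Finset.mem_insert_self _ _),
    fun ρ φ h ↦ ?_⟩
  have key : ∀ L : List (α × Bool), (∃ k ∈ insert 1 S, L <:+ k.toWord) →
      ρ (mk L) (φ 1) = φ (mk L) := by
    intro L
    induction L with
    | nil => intro _; rw [← one_eq_mk, _root_.map_one]; rfl
    | cons s L ih =>
      rintro ⟨k, hk, hL⟩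
      have hL' : L <:+ k.toWord := (List.suffix_cons s L).trans hL
      have hmem : mk (s :: L) ∈ B := (hB _).2 ⟨_, ⟨k, hk, hL⟩, rfl⟩
      have hmem' : mk L ∈ B := (hB _).2 ⟨_, ⟨k, hk, hL'⟩, rfl⟩
      specialize ih ⟨k, hk, hL'⟩
      obtain ⟨i, ε⟩ := s
      cases ε with
      | true =>
        have e : (mk ((i, true) :: L) : FreeGroup α) = of i * mk L := rfl
        rw [e] at hmem ⊢
        rw [_root_.map_mul, Equiv.Perm.mul_apply, ih, h i _ hmem' hmem]
      | false =>
        have e : (mk ((i, false) :: L) : FreeGroup α) = (of i)⁻¹ * mk L := rfl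
        rw [e] at hmem ⊢
        have := h i _ hmem (by simpa using hmem')
        rw [_root_.map_mul, Equiv.Perm.mul_apply, ih, _root_.map_inv, Equiv.Perm.inv_eq_iff_eq, this]
        simp
  intro g hg
  obtain ⟨L, hL, rfl⟩ := (hB g).1 hg
  exact key L hL

/-- Given a finite set `S` in an ordered free group of rank two, there is an action on `ℚ` whose
orbit map at some point agrees with the order on `S`, but with nontrivial stabilizer. -/
theorem IsPosCone.exists_orderAction_freeGroup_two {P : Set (FreeGroup (Fin 2))}
    (hP : IsPosCone P) (S : Finset (FreeGroup (Fin 2))) :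
    ∃ (ρ : FreeGroup (Fin 2) →* (ℚ ≃o ℚ)) (x : ℚ),
      (∀ g ∈ S, (x < ρ g x ↔ g ∈ P) ∧ (ρ g x = x → g = 1)) ∧ ∃ u ≠ 1, ρ u x = x := by
  obtain ⟨φ, hφ⟩ := hP.exists_rat_embedding
  have hφ_mul : ∀ g x y, φ (g * x) < φ (g * y) ↔ φ x < φ y := fun g x y ↦ by
    rw [hφ, hφ]; simp [mul_assoc]
  have hφ_inj : Function.Injective φ := fun x y h ↦ by
    by_contra hne
    have hne' : x⁻¹ * y ≠ 1 := fun e ↦ hne (inv_mul_eq_one.1 e)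
    rcases hP.mem_or_inv_mem hne' with k | k
    · exact ((hφ x y).2 k).ne h
    · exact ((hφ y x).2 (by simpa using k)).ne h.symm
  obtain ⟨B, hSB, hB1, hB⟩ := FreeGroup.exists_finset_orbit_eq (X := ℚ) S
  obtain ⟨M, hMB, hM⟩ := B.exists_max_image φ ⟨1, hB1⟩
  have hgen : ∀ i : Fin 2, ∃ e : ℚ ≃o ℚ,
      (∀ g ∈ B, FreeGroup.of i * g ∈ B → e (φ g) = φ (FreeGroup.of i * g)) ∧
      (e (φ M) = φ M + 1 ∨ e⁻¹ (φ M) = φ M + 1) := by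
    intro i
    rcases lt_trichotomy (φ M) (φ (FreeGroup.of i * M)) with h | h | h
    · obtain ⟨e, he, heM⟩ := exists_orderIso_extending_mul_left hφ_mul hM h (lt_add_one _)
      exact ⟨e, he, Or.inl heM⟩
    · exact absurd (hφ_inj h) (by simp)
    · rw [← hφ_mul (FreeGroup.of i)⁻¹, inv_mul_cancel_left] at h
      obtain ⟨e, he, heM⟩ := exists_orderIso_extending_mul_left hφ_mul hM h (lt_add_one _)
      refine ⟨e⁻¹, fun g hg hg' ↦ ?_, Or.inr (by simpa using heM)⟩
      have := he _ hg' (by simpa using hg)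
      rw [inv_mul_cancel_left] at this
      exact (e.symm_apply_eq).2 this.symm
  choose e he heM using hgen
  let ρ : FreeGroup (Fin 2) →* (ℚ ≃o ℚ) := FreeGroup.lift e
  have hρ : ∀ i, ρ (FreeGroup.of i) = e i := fun i ↦ FreeGroup.lift_apply_of
  let toPerm : (ℚ ≃o ℚ) →* Equiv.Perm ℚ :=
    { toFun := fun f ↦ f.toEquiv, map_one' := rfl, map_mul' := fun _ _ ↦ rfl }
  have horbit : ∀ g ∈ B, ρ g (φ 1) = φ g :=
    hB (toPerm.comp ρ) φ fun i g hg hg' ↦ by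
      change ρ (FreeGroup.of i) (φ g) = _
      rw [hρ, he i g hg hg']
  refine ⟨ρ, φ 1, fun g hg ↦ ⟨?_, fun h ↦ ?_⟩, ?_⟩
  · rw [horbit g (hSB hg), hφ]; simp
  · rw [horbit g (hSB hg)] at h
    exact hφ_inj h
  · have hup : ∀ i, ∃ t, (t = FreeGroup.of i ∨ t = (FreeGroup.of i)⁻¹) ∧
        ρ t (φ M) = φ M + 1 := by
      intro i
      rcases heM i with h | h
      · exact ⟨_, Or.inl rfl, by rw [hρ, h]⟩
      · exact ⟨_, Or.inr rfl, by rw [map_inv, hρ, h]⟩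
    obtain ⟨s, hs, hsM⟩ := hup 0
    obtain ⟨t, ht, htM⟩ := hup 1
    have hst : s ≠ t := by
      rcases hs with rfl | rfl <;> rcases ht with rfl | rfl <;> decide
    refine ⟨(s * M)⁻¹ * (t * M), fun h ↦ hst ?_, ?_⟩
    · exact mul_right_cancel (inv_mul_eq_one.1 h)
    · have hs' : ρ (s * M) (φ 1) = φ M + 1 := by
        rw [map_mul, RelIso.mul_apply, horbit M hMB, hsM]
      have ht' : ρ (t * M) (φ 1) = φ M + 1 := by
        rw [map_mul, RelIso.mul_apply, horbit M hMB, htM]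
      rw [map_mul, RelIso.mul_apply, ht', ← hs', map_inv]
      exact (ρ (s * M)).symm_apply_apply _

/-- The space `LO(F₂)` of left-invariant positive cones of the free group on two
generators has no isolated points. -/
theorem LOSpace_freeGroup_two_no_isolated_points :
    ∀ p : LOSpace (FreeGroup (Fin 2)),
      ¬ IsOpen ({p} : Set (LOSpace (FreeGroup (Fin 2)))) := by
  classical
  rintro ⟨p, hp⟩ hopen
  obtain ⟨U, hU, hUp⟩ := isOpen_induced_iff.1 hopen
  have hpU : p ∈ U := by
    have : (⟨p, hp⟩ : LOSpace (FreeGroup (Fin 2))) ∈ Subtype.val ⁻¹' U := by rw [hUp]; rfl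
    exact this
  obtain ⟨S, V, hV, hVU⟩ := isOpen_pi_iff.1 hU p hpU
  have hunique : ∀ Q : Set (FreeGroup (Fin 2)), IsPosCone Q →
      (∀ g ∈ S, g ∈ Q ↔ p g = true) → ∀ g, g ∈ Q ↔ p g = true := by
    intro Q hQ hQS
    let q : LOSpace (FreeGroup (Fin 2)) := ⟨fun g ↦ decide (g ∈ Q), by simpa using hQ⟩
    have hq : q ∈ Subtype.val ⁻¹' U := by
      refine hVU fun g hg ↦ ?_
      have : q.val g = p g := by
        rw [Bool.eq_iff_iff]
        simpa [q] using hQS g hg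
      rw [this]
      exact (hV g hg).2
    rw [hUp] at hq
    intro g
    have : q.val g = p g := congrFun (congrArg Subtype.val hq) g
    rw [← this]
    simp [q]
  obtain ⟨ρ, x, hS, u, hu, hux⟩ := hp.exists_orderAction_freeGroup_two S
  have hagree : ∀ Q : Set (FreeGroup (Fin 2)), IsPosCone Q → ∀ g ∈ S,
      g ∈ {g | x < ρ g x ∨ ρ g x = x ∧ g ∈ Q} ↔ p g = true := by
    intro Q hQ g hg
    obtain ⟨h₁, h₂⟩ := hS g hg
    refine ⟨?_, fun h ↦ Or.inl (h₁.2 h)⟩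
    rintro (h | ⟨h, hgQ⟩)
    · exact h₁.1 h
    · exact absurd (h₂ h ▸ hgQ) hQ.one_notMem
  have h₁ := hunique _ (hp.of_orderAction ρ x) (hagree _ hp) u
  have h₂ := hunique _ (hp.inv.of_orderAction ρ x) (hagree _ hp.inv) u
  simp only [Set.mem_ofPred_eq, hux, lt_irrefl, true_and, false_or] at h₁ h₂
  rcases hp.mem_or_inv_mem hu with h | h
  · exact hp.inv_notMem h (h₂.2 h)
  · exact hp.inv_notMem h (by simpa using h₂.1 h)
end

section
/- The space O(F₂) of bi-invariant positive cones of the free group F₂ on two generators has no isolated points. -/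
/-- The space `O(G)` of bi-invariant positive cones of `G`, topologized as a
subspace of the product space `{0,1}^G` via characteristic functions. -/
abbrev OSpace (G : Type*) [Group G] : Type _ :=
  {f : G → Bool // IsBiPosCone {g | f g = true}}

/-! ### Automorphisms that are positive near the top of a chain -/

/-- An automorphism `f` of a chain is positive at the top if it is nowhere decreasing above
some point that it strictly increases. -/
def TopPos {Ω : Type*} [LinearOrder Ω] (f : Ω ≃o Ω) : Prop :=
  ∃ z, z < f z ∧ ∀ z' ≥ z, z' ≤ f z'

namespace TopPos

variable {Ω : Type*} [LinearOrder Ω] {f g : Ω ≃o Ω}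

theorem mul (hf : TopPos f) (hg : TopPos g) : TopPos (f * g) := by
  obtain ⟨a, ha, ha'⟩ := hf
  obtain ⟨b, hb, hb'⟩ := hg
  have key : ∀ z ≥ a, z ≥ b → g z ≤ f (g z) := fun z h1 h2 => ha' _ (h1.trans (hb' z h2))
  rcases le_total a b with h | h
  · refine ⟨b, lt_of_lt_of_le hb (key b h le_rfl), fun z hz => ?_⟩
    exact (hb' z hz).trans (key z (h.trans hz) hz)
  · refine ⟨a, lt_of_lt_of_le ha ?_, fun z hz => ?_⟩
    · exact f.monotone (hb' a h)
    · exact (hb' z (h.trans hz)).trans (key z hz (h.trans hz))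

theorem conj (hf : TopPos f) (g : Ω ≃o Ω) : TopPos (g * f * g⁻¹) := by
  obtain ⟨a, ha, ha'⟩ := hf
  have inv (x : Ω) : g⁻¹ (g x) = x := g.symm_apply_apply x
  have inv' (x : Ω) : g (g⁻¹ x) = x := g.apply_symm_apply x
  refine ⟨g a, ?_, fun z hz => ?_⟩
  · simpa [RelIso.mul_apply, inv] using ha
  · have h1 : a ≤ g⁻¹ z := by
      rw [← g.le_iff_le, inv']; exact hz
    have := g.monotone (ha' _ h1)
    rw [inv'] at this
    exact this

theorem not_one : ¬ TopPos (1 : Ω ≃o Ω) := fun ⟨_, h, _⟩ => lt_irrefl _ h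

theorem conj_iff (g : Ω ≃o Ω) : TopPos (g * f * g⁻¹) ↔ TopPos f := by
  refine ⟨fun h => ?_, fun h => h.conj g⟩
  have := h.conj g⁻¹
  simpa [mul_assoc] using this

theorem inv_of_neg (h : ∃ z, f z < z ∧ ∀ z' ≥ z, f z' ≤ z') : TopPos f⁻¹ := by
  obtain ⟨z, h1, h2⟩ := h
  have inv (x : Ω) : f⁻¹ (f x) = x := f.symm_apply_apply x
  have inv' (x : Ω) : f (f⁻¹ x) = x := f.apply_symm_apply x
  refine ⟨f z, by rwa [inv], fun x hx => ?_⟩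
  have h3 : z ≤ f⁻¹ x := by rwa [← f.le_iff_le, inv']
  simpa [inv'] using h2 _ h3

end TopPos

/-- The trichotomy `f` positive at the top, `f⁻¹` positive at the top, or `f = 1`. -/
def Tri {Ω : Type*} [LinearOrder Ω] (f : Ω ≃o Ω) : Prop :=
  TopPos f ∨ TopPos f⁻¹ ∨ f = 1

namespace Tri

variable {Ω : Type*} [LinearOrder Ω] {f : Ω ≃o Ω}

theorem inv (h : Tri f) : Tri f⁻¹ := by
  rcases h with h | h | h
  · exact Or.inr (Or.inl (by rwa [inv_inv]))
  · exact Or.inl h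
  · exact Or.inr (Or.inr (by rw [h, inv_one]))

theorem conj_iff (g : Ω ≃o Ω) : Tri (g * f * g⁻¹) ↔ Tri f := by
  have : (g * f * g⁻¹)⁻¹ = g * f⁻¹ * g⁻¹ := by group
  unfold Tri
  rw [this, TopPos.conj_iff, TopPos.conj_iff, conj_eq_one_iff]

end Tri

namespace IsBiPosCone

variable {G : Type*} [Group G] {P : Set G}

theorem mul_mem (h : IsBiPosCone P) {a b : G} (ha : a ∈ P) (hb : b ∈ P) : a * b ∈ P :=
  h.1.1 a ha b hb

theorem conj_mem (h : IsBiPosCone P) (g : G) {a : G} (ha : a ∈ P) : g * a * g⁻¹ ∈ P :=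
  h.2 g a ha

theorem one_notMem (h : IsBiPosCone P) : (1 : G) ∉ P := by
  have := h.1.2 1
  simp at this
  tauto

theorem inv_notMem (h : IsBiPosCone P) {a : G} (ha : a ∈ P) : a⁻¹ ∉ P := by
  have := h.1.2 a
  tauto

theorem mem_or_inv_mem (h : IsBiPosCone P) {a : G} (ha : a ≠ 1) : a ∈ P ∨ a⁻¹ ∈ P := by
  have := h.1.2 a
  tauto

theorem mk' (mul : ∀ a ∈ P, ∀ b ∈ P, a * b ∈ P) (conj : ∀ g : G, ∀ p ∈ P, g * p * g⁻¹ ∈ P)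
    (one : (1 : G) ∉ P) (tot : ∀ a, a ≠ 1 → a ∈ P ∨ a⁻¹ ∈ P) : IsBiPosCone P := by
  refine ⟨⟨mul, fun g => ?_⟩, conj⟩
  have h1 : ¬ (g ∈ P ∧ g⁻¹ ∈ P) := fun h => one (by simpa using mul _ h.1 _ h.2)
  by_cases hg : g = 1
  · subst hg; simp [one]
  · have := tot g hg
    tauto

theorem inv (h : IsBiPosCone P) : IsBiPosCone {g | g⁻¹ ∈ P} := by
  refine mk' (fun a ha b hb => ?_) (fun g p hp => ?_) ?_ (fun a ha => ?_)
  · simpa using h.mul_mem hb ha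
  · simpa [mul_assoc] using h.conj_mem g hp
  · simpa using h.one_notMem
  · simpa [or_comm] using h.mem_or_inv_mem ha

/-- The order on `G` obtained from an action on a chain, refined on the kernel by a cone. -/
theorem ofAction {Ω : Type*} [LinearOrder Ω] (ρ : G →* (Ω ≃o Ω)) (hρ : ∀ c, Tri (ρ c))
    (hP : IsBiPosCone P) : IsBiPosCone {c | TopPos (ρ c) ∨ (ρ c = 1 ∧ c ∈ P)} := by
  refine mk' ?_ ?_ ?_ ?_
  · rintro a (ha | ha) b (hb | hb)
    · exact Or.inl (by rw [map_mul]; exact ha.mul hb)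
    · exact Or.inl (by rw [map_mul, hb.1, mul_one]; exact ha)
    · exact Or.inl (by rw [map_mul, ha.1, one_mul]; exact hb)
    · exact Or.inr ⟨by rw [map_mul, ha.1, hb.1, mul_one], hP.mul_mem ha.2 hb.2⟩
  · rintro g p (hp | hp)
    · exact Or.inl (by rw [map_mul, map_mul, map_inv]; exact hp.conj _)
    · exact Or.inr ⟨by rw [map_mul, map_mul, map_inv, hp.1]; simp, hP.conj_mem g hp.2⟩
  · rintro (h | h)
    · rw [map_one] at h; exact TopPos.not_one h
    · exact hP.one_notMem h.2
  · intro a ha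
    rcases hρ a with h | h | h
    · exact Or.inl (Or.inl h)
    · exact Or.inr (Or.inl (by rwa [map_inv]))
    · rcases hP.mem_or_inv_mem ha with h' | h'
      · exact Or.inl (Or.inr ⟨h, h'⟩)
      · exact Or.inr (Or.inr ⟨by rw [map_inv, h, inv_one], h'⟩)

end IsBiPosCone

/-! ### Ladders of copies of a convex piece of a chain -/

/-- A convex region of a chain `Ω` made of `ℤ`-many consecutive copies of `R ⊆ Ω`,
the copy of index `0` being `R` itself. -/
structure Ladder (Ω : Type*) [LinearOrder Ω] where
  /-- the base piece -/
  R : Set Ω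
  /-- the copies -/
  emb : ℤ → Ω → Ω
  emb_zero : ∀ r ∈ R, emb 0 r = r
  emb_lt : ∀ k k', ∀ r ∈ R, ∀ r' ∈ R, (emb k r < emb k' r' ↔ k < k' ∨ (k = k' ∧ r < r'))
  cover : ∀ z, (∃ k, ∃ r ∈ R, z = emb k r) ∨ (∀ k, ∀ r ∈ R, z < emb k r) ∨
    (∀ k, ∀ r ∈ R, emb k r < z)

namespace Ladder

variable {Ω : Type*} [LinearOrder Ω] (K : Ladder Ω)

/-- The region covered by the copies. -/
def region : Set Ω := {z | ∃ k, ∃ r ∈ K.R, z = K.emb k r}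

variable {K}

theorem emb_mem {k : ℤ} {r : Ω} (hr : r ∈ K.R) : K.emb k r ∈ K.region := ⟨k, r, hr, rfl⟩

theorem emb_inj {k k' : ℤ} {r r' : Ω} (hr : r ∈ K.R) (hr' : r' ∈ K.R)
    (h : K.emb k r = K.emb k' r') : k = k' ∧ r = r' := by
  have h1 := (K.emb_lt k k' r hr r' hr').not.1 h.not_lt
  have h2 := (K.emb_lt k' k r' hr' r hr).not.1 h.not_gt
  push Not at h1 h2
  have hk : k = k' := le_antisymm h2.1 h1.1
  exact ⟨hk, le_antisymm (h2.2 hk.symm) (h1.2 hk)⟩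

theorem R_subset {r : Ω} (hr : r ∈ K.R) : r ∈ K.region := ⟨0, r, hr, (K.emb_zero r hr).symm⟩

theorem emb_notMem {k : ℤ} {r : Ω} (hr : r ∈ K.R) (hk : k ≠ 0) : K.emb k r ∉ K.R := fun h => by
  have := emb_inj hr h (K.emb_zero _ h).symm
  exact hk this.1

variable (K) in
open Classical in
/-- Shift all copies by `n`, fixing everything outside of the region. -/
noncomputable def shiftFun (n : ℤ) (z : Ω) : Ω :=
  if h : z ∈ K.region then K.emb (h.choose + n) h.choose_spec.choose else z

theorem shiftFun_emb (n k : ℤ) {r : Ω} (hr : r ∈ K.R) :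
    K.shiftFun n (K.emb k r) = K.emb (k + n) r := by
  have h : K.emb k r ∈ K.region := emb_mem hr
  rw [shiftFun, dif_pos h]
  obtain ⟨h1, h2⟩ := h.choose_spec.choose_spec
  obtain ⟨h3, h4⟩ := emb_inj hr h1 h2
  exact congrArg₂ _ (congrArg (· + n) h3.symm) h4.symm

theorem shiftFun_of_notMem (n : ℤ) {z : Ω} (hz : z ∉ K.region) : K.shiftFun n z = z := by
  rw [shiftFun, dif_neg hz]

theorem shiftFun_strictMono (n : ℤ) : StrictMono (K.shiftFun n) := by
  intro a b hab
  rcases K.cover a with ⟨k, r, hr, rfl⟩ | ha | ha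
  · rw [shiftFun_emb _ _ hr]
    rcases K.cover b with ⟨k', r', hr', rfl⟩ | hb | hb
    · rw [shiftFun_emb _ _ hr', K.emb_lt _ _ _ hr _ hr']
      rw [K.emb_lt _ _ _ hr _ hr'] at hab
      simpa using hab
    · exact absurd hab (hb k r hr).not_gt
    · rw [shiftFun_of_notMem]
      · exact hb _ _ hr
      · rintro ⟨k', r', hr', rfl⟩
        exact lt_irrefl _ (hb k' r' hr')
  · have hna : a ∉ K.region := by
      rintro ⟨k', r', hr', rfl⟩
      exact lt_irrefl _ (ha k' r' hr')
    rw [shiftFun_of_notMem _ hna]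
    by_cases hb : b ∈ K.region
    · obtain ⟨k, r, hr, rfl⟩ := hb
      rw [shiftFun_emb _ _ hr]
      exact ha _ _ hr
    · rwa [shiftFun_of_notMem _ hb]
  · have hna : a ∉ K.region := by
      rintro ⟨k', r', hr', rfl⟩
      exact lt_irrefl _ (ha k' r' hr')
    rw [shiftFun_of_notMem _ hna]
    by_cases hb : b ∈ K.region
    · obtain ⟨k, r, hr, rfl⟩ := hb
      exact absurd hab (ha k r hr).not_gt
    · rwa [shiftFun_of_notMem _ hb]

theorem shiftFun_shiftFun (m n : ℤ) (z : Ω) :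
    K.shiftFun m (K.shiftFun n z) = K.shiftFun (n + m) z := by
  by_cases hz : z ∈ K.region
  · obtain ⟨k, r, hr, rfl⟩ := hz
    rw [shiftFun_emb _ _ hr, shiftFun_emb _ _ hr, shiftFun_emb _ _ hr, add_assoc]
  · rw [shiftFun_of_notMem _ hz, shiftFun_of_notMem _ hz, shiftFun_of_notMem _ hz]

theorem shiftFun_zero (z : Ω) : K.shiftFun 0 z = z := by
  by_cases hz : z ∈ K.region
  · obtain ⟨k, r, hr, rfl⟩ := hz
    rw [shiftFun_emb _ _ hr, add_zero]
  · rw [shiftFun_of_notMem _ hz]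

variable (K) in
/-- The shift of the ladder as an automorphism. -/
noncomputable def shift (n : ℤ) : Ω ≃o Ω where
  toFun := K.shiftFun n
  invFun := K.shiftFun (-n)
  left_inv z := by rw [shiftFun_shiftFun, add_neg_cancel, shiftFun_zero]
  right_inv z := by rw [shiftFun_shiftFun, neg_add_cancel, shiftFun_zero]
  map_rel_iff' := (shiftFun_strictMono n).le_iff_le

theorem shift_emb (n k : ℤ) {r : Ω} (hr : r ∈ K.R) :
    K.shift n (K.emb k r) = K.emb (k + n) r := shiftFun_emb n k hr

theorem shift_of_notMem (n : ℤ) {z : Ω} (hz : z ∉ K.region) : K.shift n z = z :=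
  shiftFun_of_notMem n hz

theorem shift_mul (m n : ℤ) : K.shift m * K.shift n = K.shift (n + m) := by
  ext z
  exact shiftFun_shiftFun m n z

theorem shift_zero : K.shift 0 = 1 := by
  ext z
  exact shiftFun_zero z

theorem shift_inv (n : ℤ) : (K.shift n)⁻¹ = K.shift (-n) := by
  rw [inv_eq_iff_mul_eq_one, shift_mul, neg_add_cancel, shift_zero]

variable (K) in
/-- Automorphisms supported in the base piece. -/
def Loc (f : Ω ≃o Ω) : Prop := ∀ z, z ∉ K.R → f z = z

theorem Loc.mem {f : Ω ≃o Ω} (hf : K.Loc f) {z : Ω} (hz : z ∈ K.R) : f z ∈ K.R := by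
  by_contra h
  have := f.injective (hf _ h)
  exact h (this.symm ▸ hz)

theorem Loc.one : K.Loc 1 := fun _ _ => rfl

theorem Loc.mul {f g : Ω ≃o Ω} (hf : K.Loc f) (hg : K.Loc g) : K.Loc (f * g) := fun z hz => by
  rw [RelIso.mul_apply, hg z hz, hf z hz]

theorem Loc.inv {f : Ω ≃o Ω} (hf : K.Loc f) : K.Loc f⁻¹ := fun z hz => by
  have : f⁻¹ (f z) = z := f.symm_apply_apply z
  rwa [hf z hz] at this

variable (K) in
/-- `w` moves the copies by `e`, acting on the `i`-th one by `v i`. -/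
structure Form (e : ℤ) (v : ℤ → Ω ≃o Ω) (w : Ω ≃o Ω) : Prop where
  loc : ∀ i, K.Loc (v i)
  fin : {i | v i ≠ 1}.Finite
  emb : ∀ i, ∀ r ∈ K.R, w (K.emb i r) = K.emb (i + e) (v i r)
  out : ∀ z, z ∉ K.region → w z = z

namespace Form

variable {e : ℤ} {v : ℤ → Ω ≃o Ω} {w : Ω ≃o Ω}

theorem one : K.Form 0 (fun _ => 1) 1 where
  loc _ := Loc.one
  fin := by simp
  emb i r _ := by simp
  out _ _ := rfl

theorem shift_mul (h : K.Form e v w) (δ : ℤ) : K.Form (e + δ) v (K.shift δ * w) where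
  loc := h.loc
  fin := h.fin
  emb i r hr := by
    rw [RelIso.mul_apply, h.emb i r hr, shift_emb _ _ ((h.loc i).mem hr), add_assoc]
  out z hz := by rw [RelIso.mul_apply, h.out z hz, shift_of_notMem _ hz]

theorem loc_mul (h : K.Form e v w) {f : Ω ≃o Ω} (hf : K.Loc f) :
    K.Form e (fun i => if i + e = 0 then f * v i else v i) (f * w) where
  loc i := by
    split_ifs
    · exact hf.mul (h.loc i)
    · exact h.loc i
  fin := by
    refine (h.fin.union (Set.finite_singleton (-e))).subset fun i hi => ?_
    by_cases hie : i + e = 0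
    · right
      simp only [Set.mem_singleton_iff]
      lia
    · left
      simpa [hie] using hi
  emb i r hr := by
    rw [RelIso.mul_apply, h.emb i r hr]
    have hm := (h.loc i).mem hr
    split_ifs with hi
    · rw [hi, K.emb_zero _ hm, RelIso.mul_apply, K.emb_zero _ (hf.mem hm)]
    · exact hf _ (emb_notMem hm hi)
  out z hz := by rw [RelIso.mul_apply, h.out z hz, hf z fun h => hz (R_subset h)]

theorem inv (h : K.Form e v w) : K.Form (-e) (fun i => (v (i - e))⁻¹) w⁻¹ where
  loc i := (h.loc _).inv
  fin := by
    refine (h.fin.image (· + e)).subset fun i hi => ⟨i - e, ?_, by simp⟩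
    simpa using hi
  emb i r hr := by
    have hm := (h.loc (i - e)).inv.mem hr
    have h1 : w (K.emb (i - e) ((v (i - e))⁻¹ r)) = K.emb i r := by
      rw [h.emb _ _ hm, sub_add_cancel]
      congr 1
      exact (v (i - e)).apply_symm_apply r
    rw [← h1, ← sub_eq_add_neg]
    exact w.symm_apply_apply _
  out z hz := by
    have : w⁻¹ (w z) = z := w.symm_apply_apply z
    rwa [h.out z hz] at this

theorem topPos_of_pos (h : K.Form e v w) (he : 0 < e) (hR : K.R.Nonempty) : TopPos w := by
  obtain ⟨r, hr⟩ := hR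
  have key : ∀ i, ∀ r ∈ K.R, K.emb i r < w (K.emb i r) := fun i r hr => by
    rw [h.emb i r hr, K.emb_lt _ _ _ hr _ ((h.loc i).mem hr)]
    left; lia
  refine ⟨K.emb 0 r, key 0 r hr, fun z _ => ?_⟩
  by_cases hz : z ∈ K.region
  · obtain ⟨i, r, hr, rfl⟩ := hz
    exact (key i r hr).le
  · rw [h.out z hz]

theorem topPos_of_top (h : K.Form 0 v w) {i : ℤ} (hi : TopPos (v i)) (ht : ∀ j > i, v j = 1) :
    TopPos w := by
  obtain ⟨z₀, h1, h2⟩ := hi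
  have hz₀ : z₀ ∈ K.R := by
    by_contra hz
    rw [h.loc i _ hz] at h1
    exact lt_irrefl _ h1
  refine ⟨K.emb i z₀, ?_, fun z hz => ?_⟩
  · rw [h.emb _ _ hz₀, K.emb_lt _ _ _ hz₀ _ ((h.loc i).mem hz₀)]
    right; simpa using h1
  · by_cases hz' : z ∈ K.region
    · obtain ⟨j, r, hr, rfl⟩ := hz'
      have hm := (h.loc j).mem hr
      rw [h.emb _ _ hr, add_zero]
      rw [ge_iff_le, ← not_lt, K.emb_lt _ _ _ hr _ hz₀] at hz
      rw [← not_lt, K.emb_lt _ _ _ hm _ hr]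
      push Not at hz ⊢
      refine ⟨le_rfl, fun _ => ?_⟩
      rcases hz.1.eq_or_lt with rfl | hlt
      · exact h2 _ (hz.2 rfl)
      · rw [ht j hlt]; rfl
    · rw [h.out z hz']

theorem tri (h : K.Form e v w) (hv : ∀ i, Tri (v i)) : Tri w := by
  by_cases hR : K.R.Nonempty
  · rcases lt_trichotomy e 0 with he | rfl | he
    · exact Or.inr (Or.inl (h.inv.topPos_of_pos (by lia) hR))
    · by_cases hne : {i | v i ≠ 1}.Nonempty
      · obtain ⟨i, hi, hmax⟩ := h.fin.exists_maximalFor id _ hne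
        have ht : ∀ j > i, v j = 1 := fun j hj => by
          by_contra hj'
          have := hmax hj' (le_of_lt hj)
          simp only [id] at this
          lia
        rcases hv i with h' | h' | h'
        · exact Or.inl (h.topPos_of_top h' ht)
        · refine Or.inr (Or.inl ?_)
          have hinv := h.inv
          rw [neg_zero] at hinv
          refine hinv.topPos_of_top (i := i) (by simpa using h') fun j hj => ?_
          simp [ht j hj]
        · exact absurd h' hi
      · refine Or.inr (Or.inr ?_)
        ext z
        by_cases hz' : z ∈ K.region
        · obtain ⟨j, r, hr, rfl⟩ := hz'
          have : v j = 1 := by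
            by_contra hj
            exact hne ⟨j, hj⟩
          rw [h.emb _ _ hr, this]
          simp
        · rw [h.out z hz']; rfl
    · exact Or.inl (h.topPos_of_pos he hR)
  · refine Or.inr (Or.inr ?_)
    ext z
    rw [h.out z]
    · rfl
    · rintro ⟨k, r, hr, -⟩
      exact hR ⟨r, hr⟩

end Form

end Ladder

/-! ### The chain of words over an acting chain -/

/-- An order-preserving action of an ordered group on a chain whose point stabilizers grow with
the point, and such that positive elements are positive high up, unless they act trivially
there. The action is faithful. -/
class ChainAction (G M : Type*) [Group G] [LinearOrder G] [LinearOrder M] extends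
    MulAction G M where
  smul_lt_smul_of_lt : ∀ (g : G) (a b : M), a < b → g • a < g • b
  fix_of_le : ∀ (g : G) (a b : M), g • a = a → a ≤ b → g • b = b
  exists_up : ∀ (g : G) (l : M), 1 < g → g • l ≠ l →
    ∃ m ≥ l, m < g • m ∧ ∀ m' ≥ m, m' ≤ g • m'
  exists_smul_ne : ∀ g : G, g ≠ 1 → ∃ l : M, g • l ≠ l

/-- A letter of the words below: a point of the chain `M` with a branch number. -/
@[ext]
structure Node (M : Type*) where
  /-- the level of the node -/
  level : M
  /-- the branch of the node -/
  branch : ℤ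

namespace Node

variable {M : Type*} [LinearOrder M]

/-- Sort key for nodes: negative branches descend, nonnegative ones ascend, and the
branch `0` is the last one at its level. -/
def key (a : Node M) : Lex ((Mᵒᵈ ×ₗ ℤ) ⊕ (M ×ₗ WithTop ℤ)) :=
  if a.branch < 0 then toLex (Sum.inl (toLex (OrderDual.toDual a.level, a.branch)))
  else toLex (Sum.inr (toLex (a.level, if a.branch = 0 then ⊤ else (a.branch : WithTop ℤ))))

omit [LinearOrder M] in
theorem key_injective : Function.Injective (key (M := M)) := by
  rintro ⟨a, i⟩ ⟨b, j⟩ h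
  unfold key at h
  dsimp only at h
  split_ifs at h <;> simp at h <;> simp_all

noncomputable instance : LinearOrder (Node M) := LinearOrder.lift' key key_injective

theorem lt_iff (a b : Node M) : a < b ↔ (a.level < b.level ∧ 0 ≤ b.branch) ∨
    (b.level < a.level ∧ a.branch < 0) ∨ (a.level = b.level ∧
      ((a.branch < 0 ∧ (b.branch < 0 → a.branch < b.branch)) ∨
        (0 < a.branch ∧ (b.branch = 0 ∨ a.branch < b.branch)))) := by
  obtain ⟨a, i⟩ := a
  obtain ⟨b, j⟩ := b
  have h : (⟨a, i⟩ : Node M) < ⟨b, j⟩ ↔ key ⟨a, i⟩ < key ⟨b, j⟩ := Iff.rfl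
  rw [h]
  unfold key
  dsimp only
  have sgn (n : ℤ) : (n < 0 ∧ n ≠ 0 ∧ ¬ 0 < n ∧ ¬ 0 ≤ n) ∨ (¬ n < 0 ∧ n = 0 ∧ ¬ 0 < n ∧ 0 ≤ n) ∨
      (¬ n < 0 ∧ n ≠ 0 ∧ 0 < n ∧ 0 ≤ n) := by lia
  rcases sgn i with ⟨hi, hi', hi2, hi3⟩ | ⟨hi, hi', hi2, hi3⟩ | ⟨hi, hi', hi2, hi3⟩ <;>
  rcases sgn j with ⟨hj, hj', hj2, hj3⟩ | ⟨hj, hj', hj2, hj3⟩ | ⟨hj, hj', hj2, hj3⟩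
  all_goals
    simp only [hi, hj, hi', hj', hi2, hj2, hj3, lt_self_iff_false, if_true, if_false, le_refl,
      Sum.Lex.inl_lt_inl_iff, Sum.Lex.inr_lt_inr_iff, Sum.Lex.inl_lt_inr, Sum.Lex.not_inr_lt_inl,
      Prod.Lex.toLex_lt_toLex, OrderDual.toDual_lt_toDual, WithTop.coe_lt_top,
      WithTop.coe_lt_coe, not_top_lt, EmbeddingLike.apply_eq_iff_eq]
    grind

end Node

namespace Node

variable {G M : Type*} [Group G] [LinearOrder G] [LinearOrder M] [ChainAction G M]

/-- Move the level of a node. -/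
def move (g : G) (a : Node M) : Node M := ⟨g • a.level, a.branch⟩

theorem smul_lt_smul_iff (g : G) {a b : M} : g • a < g • b ↔ a < b := by
  refine ⟨fun h => ?_, ChainAction.smul_lt_smul_of_lt g a b⟩
  simpa using ChainAction.smul_lt_smul_of_lt g⁻¹ _ _ h

theorem smul_le_smul_iff (g : G) {a b : M} : g • a ≤ g • b ↔ a ≤ b := by
  rw [← not_lt, ← not_lt, smul_lt_smul_iff]

theorem move_lt_move_iff (g : G) (a b : Node M) : move g a < move g b ↔ a < b := by
  simp [lt_iff, move, smul_lt_smul_iff]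

end Node

variable {M : Type*} [LinearOrder M]

/-- Words of nodes whose last letter has branch `0`, all earlier letters have a nonzero branch,
and all letters but the first one have level below `o`. -/
def ValidWord (o : M) : List (Node M) → Prop
  | [] => False
  | [a] => a.branch = 0
  | a :: b :: l => a.branch ≠ 0 ∧ b.level < o ∧ ValidWord o (b :: l)

/-- The chain of valid words, in lexicographic order. -/
abbrev WordChain (o : M) : Type _ := {l : List (Node M) // ValidWord o l}

namespace WordChain

variable {o : M}

/-- The level of the first letter. -/
def level : WordChain o → M
  | ⟨[], h⟩ => h.elim
  | ⟨a :: _, _⟩ => a.level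

/-- The branch of the first letter. -/
def branch : WordChain o → ℤ
  | ⟨[], h⟩ => h.elim
  | ⟨a :: _, _⟩ => a.branch

theorem validWord_single (m : M) : ValidWord o [⟨m, 0⟩] := rfl

/-- The one-letter word with the given level. -/
def single (m : M) : WordChain o := ⟨[⟨m, 0⟩], validWord_single m⟩

theorem validWord_cons (z : WordChain o) (hz : z.level < o) {k : ℤ} (hk : k ≠ 0) :
    ValidWord o (⟨o, k⟩ :: z.1) := by
  obtain ⟨_ | ⟨a, l⟩, h⟩ := z
  · exact h.elim
  · exact ⟨hk, hz, h⟩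

open Classical in
/-- Put `(o, k)` in front of a word. -/
noncomputable def push (k : ℤ) (z : WordChain o) : WordChain o :=
  if h : z.level < o ∧ k ≠ 0 then ⟨⟨o, k⟩ :: z.1, validWord_cons z h.1 h.2⟩ else z

theorem push_of_ne {k : ℤ} {z : WordChain o} (hz : z.level < o) (hk : k ≠ 0) :
    push k z = ⟨⟨o, k⟩ :: z.1, validWord_cons z hz hk⟩ := dif_pos ⟨hz, hk⟩

theorem push_zero (z : WordChain o) : push 0 z = z := dif_neg (by simp)

theorem cons_lt_cons_iff {a b : Node M} {l l' : List (Node M)} (h : ValidWord o (a :: l))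
    (h' : ValidWord o (b :: l')) : (⟨a :: l, h⟩ : WordChain o) < ⟨b :: l', h'⟩ ↔
      a < b ∨ (a = b ∧ l < l') := by
  rw [Subtype.mk_lt_mk, List.cons_lt_cons_iff]

theorem push_lt (k k' : ℤ) (r r' : WordChain o) (hr : r.level < o) (hr' : r'.level < o) :
    push k r < push k' r' ↔ k < k' ∨ (k = k' ∧ r < r') := by
  by_cases hk : k = 0
  · by_cases hk' : k' = 0
    · simp [hk, hk', push_zero]
    · rw [hk, push_zero, push_of_ne hr' hk']
      obtain ⟨_ | ⟨a, l⟩, h⟩ := r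
      · exact h.elim
      · change a.level < o at hr
        rw [cons_lt_cons_iff, Node.lt_iff]
        have : a ≠ ⟨o, k'⟩ := by rintro rfl; exact lt_irrefl _ hr
        have := hr.not_gt
        have := hr.ne
        simp_all
        grind
  · by_cases hk' : k' = 0
    · rw [hk', push_zero, push_of_ne hr hk]
      obtain ⟨_ | ⟨a, l⟩, h⟩ := r'
      · exact h.elim
      · change a.level < o at hr'
        rw [cons_lt_cons_iff, Node.lt_iff]
        have : a ≠ ⟨o, k⟩ := by rintro rfl; exact lt_irrefl _ hr'
        have := hr'.not_gt
        have := hr'.ne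
        grind
    · rw [push_of_ne hr hk, push_of_ne hr' hk', cons_lt_cons_iff, Node.lt_iff, Node.mk.injEq]
      simp only [← Subtype.coe_lt_coe, lt_irrefl]
      grind

theorem lt_of_push_le {z : WordChain o} (hz : o ≤ z.level) :
    (∃ k, ∃ r : WordChain o, r.level < o ∧ z = push k r) ∨
      ((z.branch < 0 ∧ o < z.level) ∧ ∀ k, ∀ r : WordChain o, r.level < o → z < push k r) ∨
      ((z.branch ≥ 0 ∧ (o < z.level ∨ z.branch = 0)) ∧
        ∀ k, ∀ r : WordChain o, r.level < o → push k r < z) := by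
  obtain ⟨_ | ⟨a, l⟩, h⟩ := z
  · exact h.elim
  change o ≤ a.level at hz
  by_cases h1 : a.level = o ∧ a.branch ≠ 0
  · left
    obtain _ | ⟨b, l⟩ := l
    · exact absurd h h1.2
    · refine ⟨a.branch, ⟨b :: l, h.2.2⟩, h.2.1, ?_⟩
      rw [push_of_ne h.2.1 h1.2]
      simp [← h1.1]
  · right
    change ((a.branch < 0 ∧ o < a.level) ∧ _) ∨ ((a.branch ≥ 0 ∧ (o < a.level ∨ a.branch = 0)) ∧ _)
    rcases lt_or_ge a.branch 0 with hb | hb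
    · have ha : o < a.level := lt_of_le_of_ne hz fun h' => h1 ⟨h'.symm, hb.ne⟩
      refine Or.inl ⟨⟨hb, ha⟩, fun k r hr => ?_⟩
      by_cases hk : k = 0
      · rw [hk, push_zero]
        obtain ⟨_ | ⟨b, l'⟩, h'⟩ := r
        · exact h'.elim
        · change b.level < o at hr
          rw [cons_lt_cons_iff, Node.lt_iff]
          exact Or.inl (Or.inr (Or.inl ⟨hr.trans ha, hb⟩))
      · rw [push_of_ne hr hk, cons_lt_cons_iff, Node.lt_iff]
        exact Or.inl (Or.inr (Or.inl ⟨ha, hb⟩))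
    · have ha : o < a.level ∨ a.branch = 0 := by
        by_contra! hcon
        exact h1 ⟨le_antisymm hcon.1 hz, hcon.2⟩
      refine Or.inr ⟨⟨hb, ha⟩, fun k r hr => ?_⟩
      by_cases hk : k = 0
      · rw [hk, push_zero]
        obtain ⟨_ | ⟨b, l'⟩, h'⟩ := r
        · exact h'.elim
        · change b.level < o at hr
          rw [cons_lt_cons_iff, Node.lt_iff]
          exact Or.inl (Or.inl ⟨hr.trans_le hz, hb⟩)
      · rw [push_of_ne hr hk, cons_lt_cons_iff, Node.lt_iff]
        rcases hz.lt_or_eq with hz | hz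
        · exact Or.inl (Or.inl ⟨hz, hb⟩)
        · left; right; right
          refine ⟨hz, ?_⟩
          have : a.branch = 0 := by simpa [hz] using ha
          grind

variable (o) in
/-- The ladder of words over the node `o`. -/
noncomputable def ladder : Ladder (WordChain o) where
  R := {z | z.level < o}
  emb := push
  emb_zero r _ := push_zero r
  emb_lt k k' r hr r' hr' := push_lt k k' r r' hr hr'
  cover z := by
    rcases lt_or_ge z.level o with hz | hz
    · exact Or.inl ⟨0, z, hz, (push_zero z).symm⟩
    · rcases lt_of_push_le hz with h | h | h
      · exact Or.inl h
      · exact Or.inr (Or.inl h.2)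
      · exact Or.inr (Or.inr h.2)

theorem mem_R {z : WordChain o} : z ∈ (ladder o).R ↔ z.level < o := Iff.rfl

theorem notMem_region {z : WordChain o} (h : o < z.level ∨ (o = z.level ∧ z.branch = 0)) :
    z ∉ (ladder o).region := by
  rintro ⟨k, r, hr, rfl⟩
  change r.level < o at hr
  change o < (push k r).level ∨ (o = (push k r).level ∧ (push k r).branch = 0) at h
  by_cases hk : k = 0
  · rw [hk, push_zero] at h
    grind
  · rw [push_of_ne hr hk] at h
    change o < o ∨ (o = o ∧ k = 0) at h
    simp [hk] at h

section Action

variable {G : Type*} [Group G] [LinearOrder G] [ChainAction G M]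

/-- Act on the level of the first letter. -/
def moveHead (g : G) (z : WordChain o) : WordChain o :=
  ⟨z.1.modifyHead (Node.move g), by
    obtain ⟨_ | ⟨a, _ | ⟨b, l⟩⟩, h⟩ := z
    · exact h.elim
    · exact h
    · exact h⟩

theorem moveHead_strictMono (g : G) : StrictMono (moveHead (o := o) g) := by
  rintro ⟨_ | ⟨a, l⟩, h⟩ ⟨_ | ⟨b, l'⟩, h'⟩ hlt
  · exact h.elim
  · exact h.elim
  · exact h'.elim
  · change (⟨Node.move g a :: l, _⟩ : WordChain o) < ⟨Node.move g b :: l', _⟩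
    rw [cons_lt_cons_iff] at hlt
    refine (cons_lt_cons_iff _ _).2 ?_
    rcases hlt with hlt | ⟨rfl, hlt⟩
    · exact Or.inl ((Node.move_lt_move_iff g a b).2 hlt)
    · exact Or.inr ⟨rfl, hlt⟩

theorem moveHead_mul (g g' : G) (z : WordChain o) :
    moveHead (g * g') z = moveHead g (moveHead g' z) := by
  obtain ⟨_ | ⟨a, l⟩, h⟩ := z
  · exact h.elim
  · simp [moveHead, Node.move, mul_smul]

theorem moveHead_one (z : WordChain o) : moveHead (1 : G) z = z := by
  obtain ⟨_ | ⟨a, l⟩, h⟩ := z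
  · exact h.elim
  · simp [moveHead, Node.move]

variable (o G) in
/-- The action on words through the level of the first letter. -/
def act : G →* (WordChain o ≃o WordChain o) where
  toFun g :=
    { toFun := moveHead g
      invFun := moveHead g⁻¹
      left_inv := fun z => by rw [← moveHead_mul, inv_mul_cancel, moveHead_one (G := G)]
      right_inv := fun z => by rw [← moveHead_mul, mul_inv_cancel, moveHead_one (G := G)]
      map_rel_iff' := (moveHead_strictMono g).le_iff_le }
  map_one' := RelIso.ext fun z => moveHead_one (G := G) z
  map_mul' g g' := RelIso.ext fun z => moveHead_mul g g' z

theorem level_act (g : G) (z : WordChain o) : (act o G g z).level = g • z.level := by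
  obtain ⟨_ | ⟨a, l⟩, h⟩ := z
  · exact h.elim
  · rfl

theorem branch_act (g : G) (z : WordChain o) : (act o G g z).branch = z.branch := by
  obtain ⟨_ | ⟨a, l⟩, h⟩ := z
  · exact h.elim
  · rfl

theorem act_eq_self {g : G} {z : WordChain o} (h : g • z.level = z.level) :
    act o G g z = z := by
  obtain ⟨_ | ⟨a, l⟩, h'⟩ := z
  · exact h'.elim
  · change g • a.level = a.level at h
    change (⟨Node.move g a :: l, _⟩ : WordChain o) = _
    simp only [Node.move, h]

theorem act_single (g : G) (m : M) : act o G g (single m) = single (g • m) := rfl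

theorem single_le_iff (m : M) (z : WordChain o) :
    single m ≤ z ↔ z = single m ∨ (m < z.level ∧ 0 ≤ z.branch) := by
  obtain ⟨_ | ⟨a, l⟩, h⟩ := z
  · exact h.elim
  · change _ ↔ _ ∨ (m < a.level ∧ 0 ≤ a.branch)
    rw [le_iff_eq_or_lt, eq_comm]
    refine or_congr_right ?_
    rw [single, cons_lt_cons_iff, Node.lt_iff]
    simp
    rintro rfl
    intro hl
    obtain _ | ⟨b, l⟩ := l
    · simp at hl
    · exact absurd rfl h.1

theorem single_lt_single (m m' : M) : (single m : WordChain o) < single m' ↔ m < m' := by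
  rw [single, single, cons_lt_cons_iff, Node.lt_iff]
  simp

theorem le_act_of_le {g : G} {z : WordChain o} (hz : 0 ≤ z.branch) (h : z.level ≤ g • z.level) :
    z ≤ act o G g z := by
  rcases h.eq_or_lt with h | h
  · rw [act_eq_self h.symm]
  · obtain ⟨_ | ⟨a, l⟩, h'⟩ := z
    · exact h'.elim
    · refine le_of_lt ?_
      change _ < (⟨Node.move g a :: l, _⟩ : WordChain o)
      exact (cons_lt_cons_iff _ _).2 (Or.inl ((Node.lt_iff _ _).2 (Or.inl ⟨h, hz⟩)))

end Action

end WordChain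

/-! ### Products of conjugates of the shift -/

namespace WordChain

variable {G M : Type*} [Group G] [LinearOrder G] [LinearOrder M]
  [ChainAction G M] {o : M}

variable (o) in
/-- A conjugate of a power of the shift. -/
noncomputable def twist (p : G) (δ : ℤ) : WordChain o ≃o WordChain o :=
  act o G p * (ladder o).shift δ * (act o G p)⁻¹

variable (o) in
/-- A product of conjugates of powers of the shift, followed by an element of `G`. -/
noncomputable def eval : List (G × ℤ) → G → (WordChain o ≃o WordChain o)
  | [], g => act o G g
  | x :: ls, g => twist o x.1 x.2 * eval ls g

/-- Translate all the conjugators of a list. -/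
def translate (d : G) (ls : List (G × ℤ)) : List (G × ℤ) := ls.map fun x => (d * x.1, x.2)

theorem act_mul_twist (d p : G) (δ : ℤ) :
    act o G d * twist o p δ = twist o (d * p) δ * act o G d := by
  simp [twist, mul_assoc]

theorem act_mul_eval (d : G) (ls : List (G × ℤ)) (g : G) :
    act o G d * eval o ls g = eval o (translate d ls) (d * g) := by
  induction ls with
  | nil => exact (map_mul _ _ _).symm
  | cons x ls ih =>
    change act o G d * (twist o x.1 x.2 * eval o ls g) =
      twist o (d * x.1) x.2 * eval o (translate d ls) (d * g)
    rw [← ih, ← mul_assoc, act_mul_twist, mul_assoc]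

theorem eval_mul_act (ls : List (G × ℤ)) (g d : G) :
    eval o ls g * act o G d = eval o ls (g * d) := by
  induction ls with
  | nil => exact (map_mul _ _ _).symm
  | cons x ls ih =>
    change twist o x.1 x.2 * eval o ls g * act o G d = twist o x.1 x.2 * eval o ls (g * d)
    rw [← ih, mul_assoc]

theorem twist_apply (p : G) (δ : ℤ) (z : WordChain o) :
    twist o p δ z = act o G p ((ladder o).shift δ (act o G p⁻¹ z)) := by
  rw [twist, ← map_inv]; rfl

theorem act_act_inv (p : G) (z : WordChain o) : act o G p (act o G p⁻¹ z) = z := by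
  rw [map_inv]
  exact (act o G p).apply_symm_apply z

theorem twist_eq_self {p : G} {δ : ℤ} {z : WordChain o}
    (h : p • o < z.level ∨ (p • o = z.level ∧ z.branch = 0)) : twist o p δ z = z := by
  have h1 : (act o G p⁻¹ z) ∉ (ladder o).region := by
    apply notMem_region
    rw [level_act, branch_act]
    rcases h with h | h
    · left
      rw [← Node.smul_lt_smul_iff p]
      simpa using h
    · right
      rw [← h.1]
      simpa using h.2
  rw [twist_apply, Ladder.shift_of_notMem _ h1, act_act_inv]

theorem eval_eq_act {ls : List (G × ℤ)} {m : M} (hls : ∀ x ∈ ls, x.1 • o ≤ m) {g : G}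
    {z : WordChain o} (hz : single m ≤ act o G g z) : eval o ls g z = act o G g z := by
  induction ls with
  | nil => rfl
  | cons x ls ih =>
    change twist o x.1 x.2 (eval o ls g z) = _
    rw [ih fun y hy => hls y (by simp [hy])]
    apply twist_eq_self
    have hx := hls x (by simp)
    rcases (single_le_iff _ _).1 hz with h | h
    · rw [h]
      rcases hx.lt_or_eq with hx | hx
      · exact Or.inl hx
      · exact Or.inr ⟨hx, rfl⟩
    · exact Or.inl (hx.trans_lt h.1)

theorem le_act_of_single_le {g : G} {m : M} (hm : ∀ m' ≥ m, m' ≤ g • m') {z : WordChain o}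
    (hz : single m ≤ z) : z ≤ act o G g z := by
  rcases (single_le_iff _ _).1 hz with rfl | h
  · exact le_act_of_le le_rfl (hm _ le_rfl)
  · exact le_act_of_le h.2 (hm _ h.1.le)

theorem topPos_eval {ls : List (G × ℤ)} {l : M} (hls : ∀ x ∈ ls, x.1 • o ≤ l) {g : G}
    (hg : 1 < g) (hl : g • l ≠ l) : TopPos (eval o ls g) := by
  obtain ⟨m, hm, h1, h2⟩ := ChainAction.exists_up g l hg hl
  have key : ∀ z : WordChain o, single m ≤ z → eval o ls g z = act o G g z := fun z hz =>
    eval_eq_act (m := m) (fun x hx => (hls x hx).trans hm) (hz.trans (le_act_of_single_le h2 hz))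
  refine ⟨single m, ?_, fun z hz => ?_⟩
  · rw [key _ le_rfl, act_single, single_lt_single]
    exact h1
  · rw [key z hz]
    exact le_act_of_single_le h2 hz

theorem topPos_inv_eval [MulLeftMono G] {ls : List (G × ℤ)} {l : M}
    (hls : ∀ x ∈ ls, x.1 • o ≤ l) {g : G}
    (hg : g < 1) (hl : g • l ≠ l) : TopPos (eval o ls g)⁻¹ := by
  have hl' : g⁻¹ • l ≠ l := fun h => hl (by rw [eq_comm, ← inv_smul_eq_iff, h])
  obtain ⟨m, hm, h1, h2⟩ := ChainAction.exists_up g⁻¹ l (one_lt_inv'.2 hg) hl'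
  have key : ∀ z : WordChain o, single m ≤ act o G g z → eval o ls g z ≤ z := fun z hz => by
    rw [eval_eq_act (m := m) (fun x hx => (hls x hx).trans hm) hz]
    have := le_act_of_single_le h2 hz
    have h3 := act_act_inv (o := o) g⁻¹ z
    rw [inv_inv] at h3
    rwa [h3] at this
  have h3 : act o G g (single (g⁻¹ • m)) = single m := by
    rw [act_single, smul_inv_smul]
  apply TopPos.inv_of_neg
  refine ⟨single (g⁻¹ • m), ?_, fun z hz => key z ?_⟩
  · rw [eval_eq_act (m := m) (fun x hx => (hls x hx).trans hm) h3.ge, h3, single_lt_single]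
    exact h1
  · rw [← h3]
    exact (act o G g).monotone hz

theorem loc_act {d : G} (hd : d • o = o) : (ladder o).Loc (act o G d) := fun z hz => by
  rw [mem_R, not_lt] at hz
  exact act_eq_self (ChainAction.fix_of_le d o _ hd hz)

theorem loc_twist {p : G} (hp : p • o < o) (δ : ℤ) : (ladder o).Loc (twist o p δ) := fun z hz => by
  rw [mem_R, not_lt] at hz
  exact twist_eq_self (Or.inl (hp.trans_le hz))

theorem loc_eval {ls : List (G × ℤ)} (hls : ∀ x ∈ ls, x.1 • o < o) {d : G} (hd : d • o = o) :
    (ladder o).Loc (eval o ls d) := by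
  induction ls with
  | nil => exact loc_act hd
  | cons x ls ih =>
    exact (loc_twist (hls x (by simp)) _).mul (ih fun y hy => hls y (by simp [hy]))

open Classical in
/-- The number of conjugators moving `o` strictly down. -/
noncomputable def lowCount (o : M) (ls : List (G × ℤ)) : ℕ := ls.countP fun x => x.1 • o < o

theorem eval_one : eval o [] (1 : G) = 1 := map_one _

theorem exists_form {ls : List (G × ℤ)} (hls : ∀ x ∈ ls, x.1 • o ≤ o) {d : G} (hd : d • o = o) :
    ∃ e v, (ladder o).Form e v (eval o ls d) ∧
      ∀ i, ∃ (ls' : List (G × ℤ)) (d' : G), v i = eval o ls' d' ∧ ls'.length ≤ lowCount o ls := by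
  induction ls with
  | nil =>
    have h := (Ladder.Form.one (K := ladder o)).loc_mul (loc_act hd)
    rw [mul_one] at h
    refine ⟨_, _, h, fun i => ?_⟩
    by_cases hi : i + 0 = 0
    · exact ⟨[], d, by rw [if_pos hi]; rfl, Nat.zero_le _⟩
    · exact ⟨[], 1, by rw [if_neg hi, eval_one], Nat.zero_le _⟩
  | cons x ls ih =>
    obtain ⟨e, v, h, hv⟩ := ih fun y hy => hls y (by simp [hy])
    obtain ⟨p, δ⟩ := x
    have hp : p • o ≤ o := hls (p, δ) (by simp)
    rcases hp.lt_or_eq with hp | hp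
    · have hcount : lowCount o ((p, δ) :: ls) = lowCount o ls + 1 := by
        simp [lowCount, hp]
      refine ⟨_, _, h.loc_mul (loc_twist hp δ), fun i => ?_⟩
      obtain ⟨ls', d', h1, h2⟩ := hv i
      by_cases hi : i + e = 0
      · refine ⟨(p, δ) :: ls', d', by rw [if_pos hi, h1]; rfl, ?_⟩
        rw [hcount, List.length_cons]
        lia
      · exact ⟨ls', d', by rw [if_neg hi, h1], by lia⟩
    · have hcount : lowCount o ((p, δ) :: ls) = lowCount o ls := by
        simp [lowCount, hp]
      have hp' : p⁻¹ • o = o := by rw [inv_smul_eq_iff, hp]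
      have h' := ((h.loc_mul (loc_act hp')).shift_mul δ).loc_mul (loc_act hp)
      have heq : act o G p * ((ladder o).shift δ * (act o G p⁻¹ * eval o ls d)) =
          eval o ((p, δ) :: ls) d := by
        simp [eval, twist, mul_assoc]
      rw [heq] at h'
      refine ⟨_, _, h', fun i => ?_⟩
      obtain ⟨ls', d', h1, h2⟩ := hv i
      have hlen (q : G) : (translate q ls').length = ls'.length := List.length_map _
      by_cases hi : i + e = 0 <;> by_cases hi' : i + (e + δ) = 0
      · refine ⟨translate p (translate p⁻¹ ls'), p * (p⁻¹ * d'), ?_, ?_⟩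
        · rw [if_pos hi, if_pos hi', h1, act_mul_eval, act_mul_eval]
        · simpa [translate, hcount] using h2
      · refine ⟨translate p⁻¹ ls', p⁻¹ * d', ?_, ?_⟩
        · rw [if_pos hi, if_neg hi', h1, act_mul_eval]
        · simpa [translate, hcount] using h2
      · refine ⟨translate p ls', p * d', ?_, ?_⟩
        · rw [if_neg hi, if_pos hi', h1, act_mul_eval]
        · simpa [translate, hcount] using h2
      · refine ⟨ls', d', ?_, ?_⟩
        · rw [if_neg hi, if_neg hi', h1]
        · simpa [hcount] using h2

theorem tri_eval [MulLeftMono G] (ls : List (G × ℤ)) (g : G) : Tri (eval o ls g) := by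
  induction hn : ls.length using Nat.strong_induction_on generalizing ls g with
  | _ n ih =>
  subst hn
  have moved : ∀ l : M, (∀ x ∈ ls, x.1 • o ≤ l) → g • l ≠ l → Tri (eval o ls g) := by
    intro l hls hl
    rcases lt_trichotomy g 1 with hg | rfl | hg
    · exact Or.inr (Or.inl (topPos_inv_eval hls hg hl))
    · exact absurd (one_smul _ _) hl
    · exact Or.inl (topPos_eval hls hg hl)
  by_cases hne : ls = []
  · by_cases hg : g = 1
    · subst hne hg
      exact Or.inr (Or.inr eval_one)
    · obtain ⟨l, hl⟩ := ChainAction.exists_smul_ne (M := M) g hg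
      exact moved l (by simp [hne]) hl
  · obtain ⟨x₀, hx₀, hmax⟩ : ∃ x₀ ∈ ls, ∀ x ∈ ls, x.1 • o ≤ x₀.1 • o := by
      classical
      obtain ⟨x₀, h1, h2⟩ := ls.toFinset.exists_max_image (fun x => x.1 • o)
        (by simpa using hne)
      exact ⟨x₀, by simpa using h1, fun x hx => h2 x (by simpa using hx)⟩
    by_cases hl : g • x₀.1 • o = x₀.1 • o
    · set p := x₀.1 with hp
      rw [← Tri.conj_iff (act o G p⁻¹), ← map_inv, act_mul_eval, eval_mul_act]
      have h1 : ∀ x ∈ translate p⁻¹ ls, x.1 • o ≤ o := by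
        intro x hx
        obtain ⟨y, hy, rfl⟩ := List.mem_map.1 hx
        rw [← Node.smul_le_smul_iff p]
        simpa [mul_smul] using hmax y hy
      have h2 : (p⁻¹ * g * p⁻¹⁻¹) • o = o := by
        rw [inv_inv, mul_smul, mul_smul, hl, inv_smul_smul]
      obtain ⟨e, v, h, hv⟩ := exists_form h1 h2
      refine h.tri fun i => ?_
      obtain ⟨ls', d', h3, h4⟩ := hv i
      rw [h3]
      refine ih ls'.length (h4.trans_lt ?_) ls' d' rfl
      have hlen : (translate p⁻¹ ls).length = ls.length := List.length_map _
      rw [← hlen, lowCount]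
      refine lt_of_le_of_ne List.countP_le_length fun hcon => ?_
      rw [List.countP_eq_length] at hcon
      have := hcon (p⁻¹ * p, x₀.2) (List.mem_map.2 ⟨x₀, hx₀, rfl⟩)
      simp at this
    · exact moved _ hmax hl

end WordChain

/-! ### The chain of cuts of a bi-ordered group -/

/-- The lower sets of an ordered group, with an order respecting their stabilizers. -/
@[ext]
structure Cut (G : Type*) [LinearOrder G] where
  /-- the underlying lower set -/
  toLowerSet : LowerSet G

namespace Cut

variable {G : Type*} [Group G] [LinearOrder G] [MulLeftMono G] [MulRightMono G]

/-- The elements mapping a cut into itself by left multiplication. -/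
def pre (A : Cut G) : LowerSet G where
  carrier := {u | ∀ a ∈ A.toLowerSet, u * a ∈ A.toLowerSet}
  lower' := fun _ _ h hu a ha => A.toLowerSet.lower (mul_le_mul_left h a) (hu a ha)

omit [MulLeftMono G] in
theorem mem_pre {A : Cut G} {u : G} :
    u ∈ A.pre ↔ ∀ a ∈ A.toLowerSet, u * a ∈ A.toLowerSet := Iff.rfl

noncomputable instance : LinearOrder (Cut G) :=
  LinearOrder.lift' (fun A : Cut G => toLex (A.pre, A.toLowerSet)) fun A B h => by
    simp only [EmbeddingLike.apply_eq_iff_eq, Prod.mk.injEq] at h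
    exact Cut.ext h.2

omit [MulLeftMono G] in
theorem lt_iff {A B : Cut G} :
    A < B ↔ A.pre < B.pre ∨ (A.pre = B.pre ∧ A.toLowerSet < B.toLowerSet) :=
  Prod.Lex.toLex_lt_toLex

omit [MulLeftMono G] in
theorem le_iff {A B : Cut G} :
    A ≤ B ↔ A.pre < B.pre ∨ (A.pre = B.pre ∧ A.toLowerSet ≤ B.toLowerSet) :=
  Prod.Lex.toLex_le_toLex

omit [MulLeftMono G] in
theorem pre_mono {A B : Cut G} (h : A ≤ B) : A.pre ≤ B.pre := by
  rcases le_iff.1 h with h | h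
  · exact h.le
  · exact h.1.le

/-- Left translate of a cut. -/
def leftMul (g : G) (A : Cut G) : Cut G where
  toLowerSet :=
    { carrier := {x | g⁻¹ * x ∈ A.toLowerSet}
      lower' := fun _ _ h hx => A.toLowerSet.lower (mul_le_mul_right h g⁻¹) hx }

instance : MulAction G (Cut G) where
  smul := leftMul
  one_smul A := by
    ext x
    change 1⁻¹ * x ∈ A.toLowerSet ↔ x ∈ A.toLowerSet
    simp
  mul_smul g h A := by
    ext x
    change (g * h)⁻¹ * x ∈ A.toLowerSet ↔ h⁻¹ * (g⁻¹ * x) ∈ A.toLowerSet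
    simp [mul_assoc]

omit [MulRightMono G] in
theorem mem_smul {g x : G} {A : Cut G} :
    x ∈ (g • A).toLowerSet ↔ g⁻¹ * x ∈ A.toLowerSet := Iff.rfl

theorem mem_pre_smul {g x : G} {A : Cut G} : x ∈ (g • A).pre ↔ g⁻¹ * x * g ∈ A.pre := by
  rw [mem_pre, mem_pre]
  refine ⟨fun h a ha => ?_, fun h a ha => ?_⟩
  · have := h (g * a) (by simpa [mem_smul] using ha)
    simpa [mem_smul, mul_assoc] using this
  · have := h (g⁻¹ * a) (mem_smul.1 ha)
    simpa [mem_smul, mul_assoc] using this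

omit [MulRightMono G] in
theorem smul_toLowerSet_le {g : G} {A B : Cut G} :
    (g • A).toLowerSet ≤ (g • B).toLowerSet ↔ A.toLowerSet ≤ B.toLowerSet := by
  refine ⟨fun h x hx => ?_, fun h x hx => h hx⟩
  have : g * x ∈ (g • B).toLowerSet := h (by simpa [mem_smul] using hx)
  simpa [mem_smul] using this

theorem smul_pre_le {g : G} {A B : Cut G} : (g • A).pre ≤ (g • B).pre ↔ A.pre ≤ B.pre := by
  refine ⟨fun h x hx => ?_, fun h x hx => ?_⟩
  · have : g * x * g⁻¹ ∈ (g • B).pre := h (mem_pre_smul.2 (by simpa [mul_assoc] using hx))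
    simpa [mul_assoc] using mem_pre_smul.1 this
  · exact mem_pre_smul.2 (h (mem_pre_smul.1 hx))

theorem smul_lt {g : G} {A B : Cut G} (h : A < B) : g • A < g • B := by
  rw [lt_iff, le_antisymm_iff, lt_iff_le_not_ge, lt_iff_le_not_ge] at h ⊢
  rwa [smul_pre_le, smul_pre_le, smul_toLowerSet_le, smul_toLowerSet_le]

theorem smul_eq_self_iff {g : G} {A : Cut G} : g • A = A ↔ g ∈ A.pre ∧ g⁻¹ ∈ A.pre := by
  refine ⟨fun h => ?_, fun h => ?_⟩
  · constructor
    · intro a ha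
      rw [← h, mem_smul]
      simpa using ha
    · intro a ha
      rw [← h, mem_smul] at ha
      exact ha
  · ext x
    change g⁻¹ * x ∈ A.toLowerSet ↔ x ∈ A.toLowerSet
    refine ⟨fun hx => ?_, fun hx => h.2 x hx⟩
    simpa using h.1 _ hx

omit [MulLeftMono G] in
theorem one_mem_pre (A : Cut G) : 1 ∈ A.pre := fun a ha => by simpa using ha

omit [MulLeftMono G] in
theorem pow_mem_pre {A : Cut G} {u : G} (hu : u ∈ A.pre) (n : ℕ) : u ^ n ∈ A.pre := by
  induction n with
  | zero => simpa using one_mem_pre A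
  | succ n ih =>
    intro a ha
    rw [pow_succ, mul_assoc]
    exact ih _ (hu a ha)

/-- The cut of the elements that are infinitely smaller than `h`. -/
def tiny (h : G) : Cut G where
  toLowerSet :=
    { carrier := {u | ∀ n : ℕ, u ^ n < h}
      lower' := fun _ _ hab ha n => (pow_le_pow_left' hab n).trans_lt (ha n) }

theorem mem_tiny {h u : G} : u ∈ (tiny h).toLowerSet ↔ ∀ n : ℕ, u ^ n < h := Iff.rfl

theorem pre_tiny {h : G} (hh : 1 < h) : (tiny h).pre = (tiny h).toLowerSet := by
  ext u
  refine ⟨fun hu => ?_, fun hu a ha n => ?_⟩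
  · have := hu 1 (mem_tiny.2 fun n => by simpa using hh)
    simpa using this
  · have h1 : u * a ≤ max u a ^ 2 := by
      rw [pow_two]
      exact mul_le_mul' (le_max_left _ _) (le_max_right _ _)
    refine (pow_le_pow_left' h1 n).trans_lt ?_
    rw [← pow_mul]
    rcases max_choice u a with h2 | h2 <;> rw [h2]
    · exact hu _
    · exact ha _

theorem pre_le_tiny {g : G} (hg : 1 < g) {A : Cut G} (h : g • A ≠ A) :
    A.pre ≤ (tiny g).toLowerSet := by
  intro u hu n
  by_contra! hn
  refine h (smul_eq_self_iff.2 ⟨A.pre.lower hn (pow_mem_pre hu n), ?_⟩)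
  exact A.pre.lower (inv_le_one'.2 hg.le) (one_mem_pre A)

theorem le_smul_of_pre_eq {g : G} (hg : 1 < g) {A : Cut G} (h : A.pre = (tiny g).toLowerSet) :
    A ≤ g • A := by
  rw [le_iff]
  right
  constructor
  · ext x
    change x ∈ A.pre ↔ x ∈ (g • A).pre
    rw [mem_pre_smul, h, mem_tiny, mem_tiny]
    refine forall_congr' fun n => ?_
    have : (g⁻¹ * x * g) ^ n = g⁻¹ * x ^ n * g := by
      have := conj_pow (i := n) (a := g⁻¹) (b := x)
      rwa [inv_inv] at this
    rw [this, ← mul_lt_mul_iff_left g⁻¹, ← mul_lt_mul_iff_right g]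
    simp [mul_assoc]
  · intro x hx
    refine A.toLowerSet.lower ?_ hx
    exact mul_le_of_le_one_left' (inv_le_one'.2 hg.le)

theorem exists_up {g : G} {l : Cut G} (hg : 1 < g) (hl : g • l ≠ l) :
    ∃ m ≥ l, m < g • m ∧ ∀ m' ≥ m, m' ≤ g • m' := by
  obtain ⟨m, h1, h2, h3⟩ : ∃ m ≥ l, m.pre = (tiny g).toLowerSet ∧ g • m ≠ m := by
    rcases (pre_le_tiny hg hl).lt_or_eq with h | h
    · refine ⟨tiny g, ?_, pre_tiny hg, fun h' => ?_⟩
      · exact le_iff.2 (Or.inl (by rwa [pre_tiny hg]))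
      · have h4 := (smul_eq_self_iff.1 h').1
        rw [pre_tiny hg] at h4
        simpa using mem_tiny.1 h4 1
    · exact ⟨l, le_rfl, h, hl⟩
  refine ⟨m, h1, lt_of_le_of_ne (le_smul_of_pre_eq hg h2) h3.symm, fun m' hm' => ?_⟩
  by_cases h4 : g • m' = m'
  · exact h4.ge
  · refine le_smul_of_pre_eq hg (le_antisymm (pre_le_tiny hg h4) ?_)
    rw [← h2]
    exact pre_mono hm'

variable (G) in
/-- The cut of the elements that are at most one. -/
def below : Cut G where
  toLowerSet := LowerSet.Iic 1

noncomputable instance : ChainAction G (Cut G) where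
  smul_lt_smul_of_lt _ _ _ h := smul_lt h
  fix_of_le g A B h hAB := by
    rw [smul_eq_self_iff] at h ⊢
    exact ⟨pre_mono hAB h.1, pre_mono hAB h.2⟩
  exists_up _ _ hg hl := exists_up hg hl
  exists_smul_ne g hg := by
    refine ⟨below G, fun h => hg ?_⟩
    obtain ⟨h1, h2⟩ := smul_eq_self_iff.1 h
    have h3 : g * 1 ≤ 1 := h1 1 (le_refl (1 : G))
    have h4 : g⁻¹ * 1 ≤ 1 := h2 1 (le_refl (1 : G))
    rw [mul_one] at h3 h4
    exact le_antisymm h3 (inv_le_one'.1 h4)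

theorem smul_tiny_ne {h s : G} (hh : 1 < h) (hs : h ≤ s) : s • tiny h ≠ tiny h := fun h' => by
  have := (smul_eq_self_iff.1 h').1
  rw [pre_tiny hh] at this
  have := mem_tiny.1 this 1
  rw [pow_one] at this
  exact this.not_ge hs

theorem smul_tiny_eq {h g : G} (hh : 1 < h) (hg : ∀ n : ℤ, g ^ n < h) :
    g • tiny h = tiny h := by
  rw [smul_eq_self_iff, pre_tiny hh, mem_tiny, mem_tiny]
  refine ⟨fun n => by simpa using hg n, fun n => by simpa using hg (-n)⟩

theorem exists_lt_tiny {h d : G} (hd : d • tiny h = tiny h) (hd1 : d ≠ 1) :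
    ∃ m, m < tiny h := by
  refine ⟨below G, lt_iff.2 (Or.inl ?_)⟩
  obtain ⟨h1, h2⟩ := smul_eq_self_iff.1 hd
  have key : (below G).pre ≤ LowerSet.Iic 1 := fun u hu => by
    have h3 : u * 1 ≤ 1 := hu 1 (le_refl (1 : G))
    rwa [mul_one] at h3
  have h4 : LowerSet.Iic (1 : G) ≤ (tiny h).pre := by
    intro u hu
    exact (tiny h).pre.lower hu (one_mem_pre _)
  refine lt_of_le_of_ne (key.trans h4) fun h5 => hd1 ?_
  rw [← h5] at h1 h2
  have h6 : d ≤ 1 := key h1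
  have h7 : d⁻¹ ≤ 1 := key h2
  exact le_antisymm h6 (inv_le_one'.1 h7)

end Cut

/-! ### Bi-orders and their cones -/

namespace IsBiPosCone

variable {G : Type*} [Group G] {P : Set G}

open Classical in
/-- The linear order with the given positive cone. -/
noncomputable abbrev linearOrder (hP : IsBiPosCone P) : LinearOrder G where
  le a b := a = b ∨ a⁻¹ * b ∈ P
  le_refl _ := Or.inl rfl
  le_trans a b c := by
    rintro (rfl | h) (rfl | h')
    · exact Or.inl rfl
    · exact Or.inr h'
    · exact Or.inr h
    · right
      simpa [mul_assoc] using hP.mul_mem h h'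
  le_antisymm a b := by
    rintro (rfl | h) (h' | h')
    · rfl
    · rfl
    · exact h'.symm
    · have := hP.inv_notMem h
      simp [h'] at this
  le_total a b := by
    by_cases h : a⁻¹ * b = 1
    · exact Or.inl (Or.inl (by rwa [inv_mul_eq_one] at h))
    · rcases hP.mem_or_inv_mem h with h | h
      · exact Or.inl (Or.inr h)
      · exact Or.inr (Or.inr (by simpa using h))
  toDecidableLE := Classical.decRel _

theorem exists_order (hP : IsBiPosCone P) :
    ∃ (_ : LinearOrder G) (_ : MulLeftMono G) (_ : MulRightMono G), ∀ g : G, g ∈ P ↔ 1 < g := by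
  let _ := hP.linearOrder
  have hle (a b : G) : a ≤ b ↔ a = b ∨ a⁻¹ * b ∈ P := Iff.rfl
  refine ⟨hP.linearOrder, ⟨fun c a b h => ?_⟩, ⟨fun c a b h => ?_⟩, fun g => ?_⟩
  · rcases h with rfl | h
    · exact Or.inl rfl
    · right
      simpa [mul_assoc] using h
  · rcases h with rfl | h
    · exact Or.inl rfl
    · right
      simpa [mul_assoc] using hP.conj_mem c⁻¹ h
  · rw [lt_iff_le_and_ne, hle]
    constructor
    · intro h
      exact ⟨Or.inr (by simpa using h), fun h' => hP.one_notMem (h' ▸ h)⟩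
    · rintro ⟨h | h, h'⟩
      · exact absurd h h'
      · simpa using h

end IsBiPosCone

/-! ### Infinitely small elements -/

section Small

variable {G : Type*} [Group G] [LinearOrder G] [MulLeftMono G] [MulRightMono G]

theorem exists_small (hNC : ∀ h : G, h ≠ 1 → ∃ x y : G, ¬ Commute (x * h * x⁻¹) (y * h * y⁻¹))
    {h : G} (hh : 1 < h) : ∃ g : G, g ≠ 1 ∧ ∀ n : ℤ, g ^ n < h := by
  by_contra! hcon
  have arch : ∀ d > 1, ∃ n : ℕ, h ≤ d ^ n := by
    intro d hd
    obtain ⟨n, hn⟩ := hcon d hd.ne'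
    obtain ⟨m, rfl | rfl⟩ := n.eq_nat_or_neg
    · exact ⟨m, by simpa using hn⟩
    · exfalso
      have h1 : d ^ (-(m : ℤ)) ≤ 1 := by
        rw [zpow_neg, zpow_natCast]
        exact inv_le_one'.2 (one_le_pow_of_one_le' hd.le m)
      exact (hh.trans_le hn).not_ge h1
  have arch' : ∀ x : G, ∀ d > 1, ∃ n : ℕ, x * h * x⁻¹ < d ^ n := by
    intro x d hd
    obtain ⟨n, hn⟩ := arch (x⁻¹ * d * x) (by
      have := mul_lt_mul_right (mul_lt_mul_left hd x) x⁻¹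
      simpa [mul_assoc] using this)
    refine ⟨n + 1, lt_of_le_of_lt ?_ (pow_lt_pow_right' hd (Nat.lt_succ_self n))⟩
    have h1 : (x⁻¹ * d * x) ^ n = x⁻¹ * d ^ n * x := by
      have := conj_pow (i := n) (a := x⁻¹) (b := d)
      rwa [inv_inv] at this
    rw [h1] at hn
    have := mul_le_mul_left (mul_le_mul_right hn x) x⁻¹
    simpa [mul_assoc] using this
  have conj_pos : ∀ x : G, 1 ≤ x * h * x⁻¹ := by
    intro x
    have := mul_le_mul_left (mul_le_mul_right hh.le x) x⁻¹
    simpa [mul_assoc] using this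
  have bracket : ∀ x : G, ∀ d > 1, ∃ k : ℕ, d ^ k ≤ x * h * x⁻¹ ∧ x * h * x⁻¹ < d ^ (k + 1) := by
    intro x d hd
    classical
    have h1 := Nat.find_spec (arch' x d hd)
    rcases hk : Nat.find (arch' x d hd) with _ | k
    · rw [hk, pow_zero] at h1
      exact absurd h1 (conj_pos x).not_gt
    · refine ⟨k, ?_, by rwa [hk] at h1⟩
      have := Nat.find_min (arch' x d hd) (m := k) (by lia)
      exact not_lt.1 this
  obtain ⟨x, y, hc, hxy⟩ : ∃ x y : G, 1 < (x * h * x⁻¹) * (y * h * y⁻¹) * (x * h * x⁻¹)⁻¹ *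
      (y * h * y⁻¹)⁻¹ ∧ True := by
    obtain ⟨x, y, hxy⟩ := hNC h hh.ne'
    rcases lt_trichotomy 1 ((x * h * x⁻¹) * (y * h * y⁻¹) * (x * h * x⁻¹)⁻¹ * (y * h * y⁻¹)⁻¹)
      with h1 | h1 | h1
    · exact ⟨x, y, h1, trivial⟩
    · refine absurd ?_ hxy
      rw [eq_comm, mul_inv_eq_one, mul_inv_eq_iff_eq_mul] at h1
      exact h1
    · refine ⟨y, x, ?_, trivial⟩
      rw [← one_lt_inv'] at h1
      convert h1 using 1
      group
  set a := x * h * x⁻¹ with ha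
  set b := y * h * y⁻¹ with hb
  set c := a * b * a⁻¹ * b⁻¹ with hcdef
  have no_half : ∀ d > 1, ¬ d * d ≤ c := by
    intro d hd hdc
    obtain ⟨k, hk1, hk2⟩ := bracket x d hd
    obtain ⟨m, hm1, hm2⟩ := bracket y d hd
    have h1 : a * b < d ^ (k + 1) * d ^ (m + 1) := mul_lt_mul_of_lt_of_lt hk2 hm2
    have h2 : d ^ m * d ^ k ≤ b * a := mul_le_mul' hm1 hk1
    have h3 : d * d * (d ^ m * d ^ k) ≤ c * (b * a) := mul_le_mul' hdc h2
    have h4 : c * (b * a) = a * b := by rw [hcdef]; group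
    have h5 : d * d * (d ^ m * d ^ k) = d ^ (k + 1) * d ^ (m + 1) := by
      rw [← pow_two, ← pow_add, ← pow_add, ← pow_add]
      congr 1
      lia
    rw [h4, h5] at h3
    exact h1.not_ge h3
  have minimal : ∀ d > 1, c ≤ d := by
    intro d hd
    by_contra! hdc
    have he : 1 < d⁻¹ * c := by rwa [lt_inv_mul_iff_mul_lt, mul_one]
    refine no_half (min d (d⁻¹ * c)) (lt_min hd he) ?_
    calc min d (d⁻¹ * c) * min d (d⁻¹ * c) ≤ d * (d⁻¹ * c) :=
          mul_le_mul' (min_le_left _ _) (min_le_right _ _)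
      _ = c := by simp
  have conj_ge : ∀ g : G, c ≤ g * c * g⁻¹ := by
    intro g
    apply minimal
    have := mul_lt_mul_left (mul_lt_mul_right hc g) g⁻¹
    simpa [mul_assoc] using this
  have central : ∀ g : G, g * c * g⁻¹ = c := by
    intro g
    refine le_antisymm ?_ (conj_ge g)
    have := mul_le_mul_left (mul_le_mul_right (conj_ge g⁻¹) g) g⁻¹
    simpa [mul_assoc] using this
  obtain ⟨x', y', hxy'⟩ := hNC c hc.ne'
  rw [central, central] at hxy'
  exact hxy' (Commute.refl c)

theorem exists_small_conj
    (hNC : ∀ h : G, h ≠ 1 → ∃ x y : G, ¬ Commute (x * h * x⁻¹) (y * h * y⁻¹))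
    {h : G} (hh : 1 < h) (X : Finset G) :
    ∃ g : G, g ≠ 1 ∧ ∀ x ∈ X, ∀ n : ℤ, (x * g * x⁻¹) ^ n < h := by
  obtain ⟨h', hh', hX⟩ : ∃ h' > 1, ∀ x ∈ X, h' ≤ x⁻¹ * h * x := by
    induction X using Finset.cons_induction with
    | empty => exact ⟨h, hh, by simp⟩
    | cons x X hx ih =>
      obtain ⟨h', h1, h2⟩ := ih
      refine ⟨min h' (x⁻¹ * h * x), lt_min h1 ?_, fun y hy => ?_⟩
      · have := mul_lt_mul_left (mul_lt_mul_right hh x⁻¹) x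
        simpa [mul_assoc] using this
      · rcases Finset.mem_cons.1 hy with rfl | hy
        · exact min_le_right _ _
        · exact (min_le_left _ _).trans (h2 y hy)
  obtain ⟨g, hg, hn⟩ := exists_small hNC hh'
  refine ⟨g, hg, fun x hx n => ?_⟩
  have h1 := (hn n).trans_le (hX x hx)
  have := mul_lt_mul_left (mul_lt_mul_right h1 x) x⁻¹
  rw [conj_zpow]
  simpa [mul_assoc] using this

end Small

/-! ### Words in the free group of rank two -/

namespace FreeGroup

variable {α : Type*} [DecidableEq α]

omit [DecidableEq α] in
theorem isReduced_append {L₁ L₂ : List (α × Bool)} : IsReduced (L₁ ++ L₂) ↔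
    IsReduced L₁ ∧ IsReduced L₂ ∧
      ∀ x ∈ L₁.getLast?, ∀ y ∈ L₂.head?, x.1 = y.1 → x.2 = y.2 :=
  List.isChain_append

omit [DecidableEq α] in
theorem IsReduced.append {L₁ L₂ : List (α × Bool)} {a b : α × Bool} (h₁ : IsReduced L₁)
    (h₂ : IsReduced L₂) (ha : L₁.getLast? = some a) (hb : L₂.head? = some b)
    (hab : a.1 = b.1 → a.2 = b.2) : IsReduced (L₁ ++ L₂) := by
  refine isReduced_append.2 ⟨h₁, h₂, fun x hx y hy => ?_⟩
  rw [ha, Option.mem_some_iff] at hx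
  rw [hb, Option.mem_some_iff] at hy
  rwa [← hx, ← hy]

/-- The inverse letter. -/
abbrev flip (x : α × Bool) : α × Bool := (x.1, !x.2)

omit [DecidableEq α] in
theorem mk_flip (x : α × Bool) : mk [flip x] = (mk [x])⁻¹ := by
  simp [inv_mk, invRev]

theorem IsReduced.eq_of_mk_eq {L₁ L₂ : List (α × Bool)} (h₁ : IsReduced L₁) (h₂ : IsReduced L₂)
    (h : mk L₁ = mk L₂) : L₁ = L₂ := by
  have := congrArg toWord h
  rwa [toWord_mk, toWord_mk, h₁.reduce_eq, h₂.reduce_eq] at this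

theorem exists_isReduced_mk_eq (h : FreeGroup α) (hh : h ≠ 1) :
    ∃ w : List (α × Bool), ∃ f ∈ w.head?, ∃ l ∈ w.getLast?, IsReduced w ∧ mk w = h := by
  have hw : h.toWord ≠ [] := by simpa using hh
  exact ⟨h.toWord, h.toWord.head hw, by simp [List.head?_eq_some_head hw],
    h.toWord.getLast hw, by simp [List.getLast?_eq_some_getLast hw], isReduced_toWord, mk_toWord⟩

theorem exists_not_commute (h : FreeGroup (Fin 2)) (hh : h ≠ 1) :
    ∃ x y : FreeGroup (Fin 2), ¬ Commute (x * h * x⁻¹) (y * h * y⁻¹) := by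
  obtain ⟨w, f, hf, l, hl, hw, rfl⟩ := exists_isReduced_mk_eq h hh
  obtain ⟨k, hkf, hkl⟩ : ∃ k : Fin 2 × Bool, (k.1 = f.1 → k.2 = f.2) ∧
      (l.1 = k.1 → l.2 = !k.2) := by
    clear hf hl
    revert f l
    decide
  obtain ⟨k', hk'⟩ : ∃ k' : Fin 2 × Bool, k'.1 ≠ k.1 := by
    clear hkf hkl
    revert k
    decide
  simp only [Option.mem_def] at hf hl
  have hne : w ≠ [] := by rintro rfl; simp at hf
  have hkw : ([k] ++ w).getLast? = some l := by rw [List.getLast?_append, hl]; rfl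
  have hW : IsReduced ([k] ++ w ++ [flip k]) :=
    (IsReduced.singleton.append hw rfl hf hkf).append IsReduced.singleton hkw rfl hkl
  have hW' : IsReduced ([k'] ++ ([k] ++ w ++ [flip k]) ++ [flip k']) :=
    (IsReduced.singleton.append hW rfl rfl fun h => absurd h hk').append IsReduced.singleton
      (a := flip k) (b := flip k') (by rw [List.getLast?_append, List.getLast?_concat]; rfl) rfl
      fun h => absurd h.symm hk'
  refine ⟨mk [k], mk [k'] * mk [k], fun hcomm => ?_⟩
  have e1 : mk [k] * mk w * (mk [k])⁻¹ = mk ([k] ++ w ++ [flip k]) := by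
    rw [← mk_flip, mul_mk, mul_mk]
  have e2 : mk [k'] * mk [k] * mk w * (mk [k'] * mk [k])⁻¹ =
      mk ([k'] ++ ([k] ++ w ++ [flip k]) ++ [flip k']) := by
    rw [mul_inv_rev, ← mk_flip, ← mk_flip]
    simp only [mul_mk, List.append_assoc]
  rw [e1, e2, commute_iff_eq, mul_mk, mul_mk] at hcomm
  have := IsReduced.eq_of_mk_eq ?_ ?_ hcomm
  · simp only [List.append_assoc, List.cons_append, List.cons.injEq] at this
    exact hk' (by rw [this.1])
  · exact hW.append hW' List.getLast?_concat rfl fun h => absurd h.symm hk'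
  · exact hW'.append hW List.getLast?_concat rfl fun h => (hk' h).elim

/-- A subgroup meeting enough conjugates of a nontrivial element contains a cyclically
reduced word. -/
theorem exists_isCyclicallyReduced (D : Subgroup (FreeGroup (Fin 2))) {g : FreeGroup (Fin 2)}
    (hg : g ≠ 1) (hgD : g ∈ D)
    (hD : ∀ k : Fin 2 × Bool, mk [k] * g * (mk [k])⁻¹ ∈ D) :
    ∃ L : List (Fin 2 × Bool), L ≠ [] ∧ IsCyclicallyReduced L ∧ mk L ∈ D := by
  obtain ⟨w, f, hf, l, hl, hw, rfl⟩ := exists_isReduced_mk_eq g hg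
  simp only [Option.mem_def] at hf hl
  have hne : w ≠ [] := by rintro rfl; simp at hf
  by_cases hcyc : IsCyclicallyReduced w
  · exact ⟨w, hne, hcyc, hgD⟩
  · have hfl : l.1 = f.1 := by
      by_contra hcon
      refine hcyc ⟨hw, fun a ha b hb hab => ?_⟩
      rw [hl, Option.mem_some_iff] at ha
      rw [hf, Option.mem_some_iff] at hb
      subst ha hb
      exact absurd hab hcon
    obtain ⟨k, hk⟩ : ∃ k : Fin 2 × Bool, k.1 ≠ f.1 := by
      clear hf hl hfl
      revert f
      decide
    refine ⟨w ++ ([k] ++ w ++ [flip k]), by simp, ⟨?_, ?_⟩, ?_⟩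
    · have hkw : ([k] ++ w).getLast? = some l := by rw [List.getLast?_append, hl]; rfl
      exact hw.append ((IsReduced.singleton.append hw rfl hf fun h => absurd h hk).append
        IsReduced.singleton hkw (b := flip k) rfl fun h => absurd (h.symm.trans hfl) hk) hl rfl
        fun h => absurd (h.symm.trans hfl) hk
    · intro a ha b hb hab
      rw [← List.append_assoc, List.getLast?_concat, Option.mem_some_iff] at ha
      rw [List.head?_append, hf, Option.some_or, Option.mem_some_iff] at hb
      subst ha hb
      exact absurd hab hk
    · rw [← mul_mk, ← mul_mk, ← mul_mk, mk_flip]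
      exact D.mul_mem hgD (hD k)

omit [DecidableEq α] in
theorem IsCyclicallyReduced.swap {L₁ L₂ : List (α × Bool)} (h : IsCyclicallyReduced (L₁ ++ L₂)) :
    IsCyclicallyReduced (L₂ ++ L₁) := by
  by_cases h1 : L₁ = []
  · simpa [h1] using h
  by_cases h2 : L₂ = []
  · simpa [h2] using h
  obtain ⟨h3, h4⟩ := h
  rw [isReduced_append] at h3
  refine ⟨isReduced_append.2 ⟨h3.2.1, h3.1, ?_⟩, ?_⟩
  · intro a ha b hb
    refine h4 a ?_ b ?_
    · rw [List.getLast?_append]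
      simp [Option.mem_def.1 ha]
    · rw [List.head?_append]
      simp [Option.mem_def.1 hb]
  · intro a ha b hb
    refine h3.2.2 a ?_ b ?_
    · rw [List.getLast?_append] at ha
      rw [List.getLast?_eq_some_getLast h1] at ha ⊢
      simpa using ha
    · rw [List.head?_append] at hb
      rw [List.head?_eq_some_head h2] at hb ⊢
      simpa using hb

end FreeGroup

/-! ### Perturbing the action at one letter -/

namespace FreeGroup

open WordChain

variable {α : Type*} [DecidableEq α] [LinearOrder (FreeGroup α)] {M : Type*} [LinearOrder M]
  [ChainAction (FreeGroup α) M] {o : M}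

/-- The action of the free group on the word chain, with the action of the letter `Y` multiplied
on the left by a power of the shift. -/
noncomputable def perturb (o : M) (Y : α × Bool) (ε : ℤ) :
    FreeGroup α →* (WordChain o ≃o WordChain o) :=
  lift fun i => if i = Y.1 then
      (if Y.2 then (ladder o).shift ε * act o _ (of i) else act o _ (of i) * (ladder o).shift (-ε))
    else act o _ (of i)

theorem perturb_self (Y : α × Bool) (ε : ℤ) :
    perturb o Y ε (mk [Y]) = (ladder o).shift ε * act o _ (mk [Y]) := by
  obtain ⟨a, _ | _⟩ := Y
  · have h : (mk [(a, false)] : FreeGroup α) = (of a)⁻¹ := mk_flip (a, true)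
    rw [h, _root_.map_inv, _root_.map_inv]
    simp [perturb, Ladder.shift_inv]
  · change perturb o (a, true) ε (of a) = _ * act o _ (of a)
    simp [perturb]

theorem perturb_flip (Y : α × Bool) (ε : ℤ) :
    perturb o Y ε (mk [flip Y]) = act o _ (mk [flip Y]) * (ladder o).shift (-ε) := by
  rw [mk_flip, _root_.map_inv, _root_.map_inv, perturb_self, mul_inv_rev, Ladder.shift_inv]

omit [DecidableEq α] [LinearOrder (FreeGroup α)] in
theorem fst_ne_of_ne {x Y : α × Bool} (h : x ≠ Y) (h' : x ≠ flip Y) : x.1 ≠ Y.1 := by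
  obtain ⟨a, s⟩ := x
  obtain ⟨b, t⟩ := Y
  rintro rfl
  cases s <;> cases t <;> simp_all [flip]

theorem perturb_of_ne {x Y : α × Bool} (ε : ℤ) (h : x ≠ Y) (h' : x ≠ flip Y) :
    perturb o Y ε (mk [x]) = act o _ (mk [x]) := by
  have hx := fst_ne_of_ne h h'
  obtain ⟨a, _ | _⟩ := x
  · have h : (mk [(a, false)] : FreeGroup α) = (of a)⁻¹ := mk_flip (a, true)
    rw [h, _root_.map_inv, _root_.map_inv]
    simp [perturb, show a ≠ Y.1 from hx]
  · change perturb o Y ε (of a) = act o _ (of a)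
    simp [perturb, show a ≠ Y.1 from hx]

/-- The conjugators picked up by the perturbed action of a word. -/
def twists (Y : α × Bool) (ε : ℤ) : List (α × Bool) → List (FreeGroup α × ℤ)
  | [] => []
  | x :: L =>
    if x = Y then (1, ε) :: translate (mk [x]) (twists Y ε L)
    else if x = flip Y then (mk [x], -ε) :: translate (mk [x]) (twists Y ε L)
    else translate (mk [x]) (twists Y ε L)

omit [DecidableEq α] [LinearOrder (FreeGroup α)] in
theorem mk_cons (x : α × Bool) (L : List (α × Bool)) : mk (x :: L) = mk [x] * mk L :=
  (mul_mk (L₁ := [x])).symm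

theorem perturb_mk (Y : α × Bool) (ε : ℤ) (L : List (α × Bool)) :
    perturb o Y ε (mk L) = eval o (twists Y ε L) (mk L) := by
  induction L with
  | nil => exact (_root_.map_one _).trans (_root_.map_one _).symm
  | cons x L ih =>
    rw [mk_cons, _root_.map_mul, ih, twists]
    split_ifs with h h'
    · subst h
      rw [perturb_self, mul_assoc, act_mul_eval, eval, twist]
      simp
    · subst h'
      rw [perturb_flip, eval, ← act_mul_eval, twist]
      simp [mul_assoc]
    · rw [perturb_of_ne ε h h', act_mul_eval]

omit [LinearOrder (FreeGroup α)] in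
theorem exists_of_mem_twists {Y : α × Bool} {ε : ℤ} {L : List (α × Bool)}
    {y : FreeGroup α × ℤ} (hy : y ∈ twists Y ε L) : ∃ L₁ L₂, L = L₁ ++ L₂ ∧ y.1 = mk L₁ ∧
      (L₂.head? = some Y ∨ L₁.getLast? = some (flip Y)) := by
  induction L generalizing y with
  | nil => simp [twists] at hy
  | cons x L ih =>
    have key : y ∈ translate (mk [x]) (twists Y ε L) → ∃ L₁ L₂, x :: L = L₁ ++ L₂ ∧
        y.1 = mk L₁ ∧ (L₂.head? = some Y ∨ L₁.getLast? = some (flip Y)) := by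
      intro hy
      obtain ⟨y', hy', rfl⟩ := List.mem_map.1 hy
      obtain ⟨L₁, L₂, rfl, h2, h3⟩ := ih hy'
      refine ⟨x :: L₁, L₂, rfl, by rw [mk_cons x L₁, h2], h3.imp_right fun h => ?_⟩
      rw [List.getLast?_cons, h]
      rfl
    rw [twists] at hy
    split_ifs at hy with h h'
    · rcases List.mem_cons.1 hy with rfl | hy
      · exact ⟨[], x :: L, rfl, rfl, Or.inl (by rw [h]; rfl)⟩
      · exact key hy
    · rcases List.mem_cons.1 hy with rfl | hy
      · exact ⟨[x], L, rfl, rfl, Or.inr (by rw [h']; rfl)⟩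
      · exact key hy
    · exact key hy

theorem tri_perturb [MulLeftMono (FreeGroup α)] (Y : α × Bool) (ε : ℤ) (c : FreeGroup α) :
    Tri (perturb o Y ε c) := by
  rw [← mk_toWord (x := c), perturb_mk]
  exact tri_eval _ _

theorem exists_prefix_max (o : M) (L : List (α × Bool)) :
    ∃ q, q <+: L ∧ ∀ q', q' <+: L → mk q' • o ≤ mk q • o := by
  obtain ⟨q, h1, h2⟩ := L.inits.toFinset.exists_max_image
    (fun q : List (α × Bool) => mk q • o)
    ⟨[], by simp⟩
  exact ⟨q, by simpa using h1, fun q' hq' => h2 q' (by simpa using hq')⟩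

theorem topPos_perturb (Y : α × Bool) (ε : ℤ) {s : FreeGroup α} (hs : 1 < s)
    (h : ∀ q, q <+: s.toWord → s • mk q • o ≠ mk q • o) : TopPos (perturb o Y ε s) := by
  obtain ⟨q, hq, hmax⟩ := exists_prefix_max o s.toWord
  rw [← mk_toWord (x := s), perturb_mk]
  refine topPos_eval (l := mk q • o) (fun y hy => ?_) (by rwa [mk_toWord])
    (by rw [mk_toWord]; exact h q hq)
  obtain ⟨L₁, L₂, h1, h2, -⟩ := exists_of_mem_twists hy
  rw [h2]
  exact hmax L₁ ⟨L₂, h1.symm⟩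

/-- A cyclically reduced word fixing `o` can be rotated so that its prefixes do not move `o` up. -/
theorem exists_rotation {L : List (α × Bool)} (hL : IsCyclicallyReduced L)
    (hLo : mk L • o = o) : ∃ L' : List (α × Bool), L'.length = L.length ∧
      IsCyclicallyReduced L' ∧ mk L' • o = o ∧ ∀ q, q <+: L' → mk q • o ≤ o := by
  obtain ⟨L₁, ⟨L₂, rfl⟩, hmax⟩ := exists_prefix_max o L
  have hfix : (mk L₁ * mk L₂) • mk L₁ • o = mk L₁ • o := by
    rw [mul_mk]
    exact ChainAction.fix_of_le _ o _ hLo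
      (by simpa [← one_eq_mk] using hmax [] (List.nil_prefix))
  refine ⟨L₂ ++ L₁, by simp [add_comm], hL.swap, ?_, fun q hq => ?_⟩
  · rw [← mul_mk, mul_smul]
    rw [mul_smul] at hfix
    exact MulAction.injective _ hfix
  · rw [← Node.smul_le_smul_iff (mk L₁)]
    obtain ⟨r, hr⟩ := hq
    rcases List.append_eq_append_iff.1 hr with ⟨u, h1, -⟩ | ⟨u, h1, h2⟩
    · rw [← mul_smul, mul_mk]
      exact hmax _ ⟨u, by rw [List.append_assoc, ← h1]⟩
    · rw [h1, ← mul_mk, mul_smul, ← mul_smul, ← hfix, Node.smul_le_smul_iff]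
      exact hmax _ ⟨r ++ L₂, by rw [← List.append_assoc, ← h2]⟩

omit [DecidableEq α] [LinearOrder (FreeGroup α)] in
theorem IsReduced.exists_eq_of_not_isCyclicallyReduced {L : List (α × Bool)} (hL : IsReduced L)
    (h : ¬ IsCyclicallyReduced L) : ∃ x mid, L = x :: (mid ++ [flip x]) := by
  by_contra! hcon
  refine h ⟨hL, fun a ha b hb hab => ?_⟩
  by_contra hab2
  cases L with
  | nil => simp at ha
  | cons x t =>
    obtain rfl : x = b := by simpa using hb
    rcases List.eq_nil_or_concat t with rfl | ⟨mid, z, rfl⟩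
    · obtain rfl : x = a := by simpa using ha
      exact hab2 rfl
    · rw [List.concat_eq_append] at *
      rw [← List.cons_append, List.getLast?_concat, Option.mem_some_iff] at ha
      subst ha
      refine hcon x mid ?_
      congr 3
      refine Prod.ext hab ?_
      simpa [Bool.eq_not] using hab2

theorem perturb_mk_conj (Y : α × Bool) (ε : ℤ) (mid : List (α × Bool)) :
    perturb o Y ε (mk (Y :: (mid ++ [flip Y]))) = (ladder o).shift ε *
      eval o (translate (mk [Y]) (twists Y ε mid)) (mk (Y :: (mid ++ [flip Y]))) *
        (ladder o).shift (-ε) := by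
  have h : (mk (Y :: (mid ++ [flip Y])) : FreeGroup α) = mk [Y] * mk mid * mk [flip Y] := by
    rw [mul_mk, mul_mk]; rfl
  rw [h, _root_.map_mul, _root_.map_mul, perturb_self, perturb_flip, perturb_mk, ← eval_mul_act,
    ← act_mul_eval]
  simp only [mul_assoc]

theorem perturb_mk_cons (Y : α × Bool) (ε : ℤ) (t : List (α × Bool)) :
    perturb o Y ε (mk (Y :: t)) = (ladder o).shift ε *
      eval o (translate (mk [Y]) (twists Y ε t)) (mk (Y :: t)) := by
  rw [mk_cons, _root_.map_mul, perturb_self, perturb_mk, ← act_mul_eval, mul_assoc]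

end FreeGroup

namespace Ladder

variable {Ω : Type*} [LinearOrder Ω] {K : Ladder Ω} {G : Type*} [Group G] [LinearOrder G]
  [MulLeftMono G] {ρ : ℤ → G →* (Ω ≃o Ω)}

theorem false_of_shift_mul (hρ : ∀ ε c, TopPos (ρ ε c) ↔ 1 < c) (hR : K.R.Nonempty) {c : G}
    (hc : ∀ ε, ∃ f, K.Loc f ∧ ρ ε c = K.shift ε * f) : False := by
  have h1 : 1 < c := by
    obtain ⟨f, hf, h⟩ := hc 1
    rw [← hρ 1, h]
    have := (Form.one.loc_mul hf).shift_mul 1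
    rw [mul_one] at this
    exact this.topPos_of_pos (by simp) hR
  have h2 : 1 < c⁻¹ := by
    obtain ⟨f, hf, h⟩ := hc (-1)
    rw [← hρ (-1), map_inv, h]
    have := ((Form.one.loc_mul hf).shift_mul (-1)).inv
    rw [mul_one] at this
    exact this.topPos_of_pos (by simp) hR
  exact absurd h1 (one_lt_inv'.1 h2).not_gt

theorem false_of_one_lt (hρ : ∀ ε c, TopPos (ρ ε c) ↔ 1 < c) {a b : G} (ha1 : 1 < a)
    (hb1 : 1 < b) (ha : ∀ ε, ∃ f, K.Loc f ∧ ρ ε a = K.shift ε * f * K.shift (-ε))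
    (hb : ∀ ε, K.Loc (ρ ε b)) : False := by
  have hpos : ∀ ε f, ρ ε a = K.shift ε * f * K.shift (-ε) → TopPos f := by
    intro ε f h
    rw [← hρ ε, h, ← shift_inv, TopPos.conj_iff] at ha1
    exact ha1
  have h1 : 1 < b⁻¹ * a := by
    obtain ⟨f, hf, h⟩ := ha 1
    rw [← hρ 1, map_mul, map_inv, h]
    have := (((Form.one.shift_mul (-1)).loc_mul hf).shift_mul 1).loc_mul (hb 1).inv
    rw [mul_one, ← mul_assoc (K.shift 1)] at this
    have h0 : (0 : ℤ) + -1 + 1 = 0 := by norm_num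
    simp only [h0] at this
    refine this.topPos_of_top (i := 1) ?_ fun j hj => ?_
    · simpa using hpos 1 f h
    · rw [if_neg (by lia), if_neg (by lia)]
  have h2 : 1 < a⁻¹ * b := by
    obtain ⟨f, hf, h⟩ := ha (-1)
    rw [← hρ (-1), map_mul, map_inv, h]
    have := ((((Form.one.loc_mul (hb (-1))).shift_mul 1).loc_mul hf.inv).shift_mul (-1))
    have h0 : (0 : ℤ) + 1 + -1 = 0 := by norm_num
    simp only [h0] at this
    have heq : (K.shift (-1) * f * K.shift (- -1))⁻¹ * ρ (-1) b =
        K.shift (-1) * (f⁻¹ * (K.shift 1 * (ρ (-1) b * 1))) := by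
      simp only [mul_inv_rev, shift_inv, neg_neg, mul_one, mul_assoc]
    rw [heq]
    refine this.topPos_of_top (i := 0) ?_ fun j hj => ?_
    · simpa using (hρ _ _).2 hb1
    · rw [if_neg (by lia), if_neg (by lia)]
  have h3 : a⁻¹ * b = (b⁻¹ * a)⁻¹ := by group
  rw [h3] at h2
  exact absurd h1 (one_lt_inv'.1 h2).not_gt

theorem false_of_conj (hρ : ∀ ε c, TopPos (ρ ε c) ↔ 1 < c) {a b : G} (ha1 : a ≠ 1)
    (hb1 : b ≠ 1) (ha : ∀ ε, ∃ f, K.Loc f ∧ ρ ε a = K.shift ε * f * K.shift (-ε))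
    (hb : ∀ ε, K.Loc (ρ ε b)) : False := by
  have ha' : ∀ ε, ∃ f, K.Loc f ∧ ρ ε a⁻¹ = K.shift ε * f * K.shift (-ε) := fun ε => by
    obtain ⟨f, hf, h⟩ := ha ε
    refine ⟨f⁻¹, hf.inv, ?_⟩
    rw [map_inv, h]
    simp only [mul_inv_rev, shift_inv, neg_neg, mul_assoc]
  have hb' : ∀ ε, K.Loc (ρ ε b⁻¹) := fun ε => by
    rw [map_inv]
    exact (hb ε).inv
  rcases ha1.lt_or_gt with h | h <;> rcases hb1.lt_or_gt with h' | h'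
  · exact false_of_one_lt hρ (one_lt_inv'.2 h) (one_lt_inv'.2 h') ha' hb'
  · exact false_of_one_lt hρ (one_lt_inv'.2 h) h' ha' hb
  · exact false_of_one_lt hρ h (one_lt_inv'.2 h') ha hb'
  · exact false_of_one_lt hρ h h' ha hb

end Ladder

namespace FreeGroup

open WordChain

variable {α : Type*} [DecidableEq α] [LinearOrder (FreeGroup α)] {M : Type*} [LinearOrder M]
  [ChainAction (FreeGroup α) M] {o : M}

omit [LinearOrder (FreeGroup α)] in
theorem IsReduced.mk_ne_one {L : List (α × Bool)} (h : IsReduced L) (hne : L ≠ []) : mk L ≠ 1 :=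
  fun hcon => hne (h.eq_of_mk_eq IsReduced.nil hcon)

theorem loc_eval_twists {Y : α × Bool} {ε : ℤ} {t u : List (α × Bool)}
    (hfix : mk (Y :: (t ++ u)) • o = o)
    (hlow : ∀ q, q <+: Y :: (t ++ u) → q ≠ [] → q ≠ Y :: (t ++ u) → mk q • o < o)
    (hu : u = [] → (Y :: t).getLast? ≠ some (flip Y)) :
    (ladder o).Loc (eval o (translate (mk [Y]) (twists Y ε t)) (mk (Y :: (t ++ u)))) := by
  refine loc_eval (fun y hy => ?_) hfix
  obtain ⟨y, hy', rfl⟩ := List.mem_map.1 hy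
  obtain ⟨L₁, L₂, rfl, h2, h3⟩ := exists_of_mem_twists hy'
  change (mk [Y] * y.1) • o < o
  rw [h2, ← mk_cons]
  refine hlow _ ⟨L₂ ++ u, by simp⟩ (by simp) fun hcon => ?_
  have hlen := congrArg List.length hcon
  simp only [List.length_cons, List.length_append] at hlen
  obtain rfl : L₂ = [] := List.length_eq_zero_iff.1 (by lia)
  obtain rfl : u = [] := List.length_eq_zero_iff.1 (by lia)
  refine hu rfl ?_
  simp only [List.head?_nil, reduceCtorEq, false_or] at h3
  rw [List.append_nil, List.getLast?_cons, h3]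
  rfl

theorem loc_perturb {Y : α × Bool} {ε : ℤ} {L : List (α × Bool)}
    (hfix : mk L • o = o) (hlow : ∀ q, q <+: L → q ≠ [] → q ≠ L → mk q • o < o)
    (hhead : L.head? ≠ some Y) (hlast : L.getLast? ≠ some (flip Y)) :
    (ladder o).Loc (perturb o Y ε (mk L)) := by
  rw [perturb_mk]
  refine loc_eval (fun y hy => ?_) hfix
  obtain ⟨L₁, L₂, rfl, h2, h3⟩ := exists_of_mem_twists hy
  rw [h2]
  refine hlow _ ⟨L₂, rfl⟩ ?_ ?_
  · rintro rfl
    simp_all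
  · intro hcon
    obtain rfl : L₂ = [] := by simpa using hcon
    rw [List.append_nil] at hlast
    simp [hlast] at h3

/-- The perturbed actions cannot all induce the same order. -/
theorem false_of_topPos_perturb [MulLeftMono (FreeGroup α)]
    (hT : ∀ (Y : α × Bool) ε c, TopPos (perturb o Y ε c) ↔ 1 < c) (hR : (ladder o).R.Nonempty)
    {L : List (α × Bool)} (hne : L ≠ []) (hL : IsCyclicallyReduced L) (hLo : mk L • o = o) :
    False := by
  induction hn : L.length using Nat.strong_induction_on generalizing L with
  | _ n ih =>
  subst hn
  have hmin : ∀ b : List (α × Bool), b ≠ [] → mk b • o = o → b.length < L.length →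
      ¬ IsCyclicallyReduced b := fun b h1 h2 h3 h4 => ih b.length h3 h1 h4 h2 rfl
  clear ih
  obtain ⟨L', hlen, hL', hLo', hle⟩ := exists_rotation hL hLo
  rw [← hlen] at hmin
  replace hne : L' ≠ [] := by
    rintro rfl
    exact hne (List.length_eq_zero_iff.1 hlen.symm)
  clear! L
  cases L' with
  | nil => exact hne rfl
  | cons Y t =>
  have hlast : (Y :: t).getLast? ≠ some (flip Y) := fun h => by
    have := hL'.2 (flip Y) h Y rfl rfl
    simp at this
  by_cases hgood : ∃ q, q <+: Y :: t ∧ q ≠ [] ∧ q ≠ Y :: t ∧ mk q • o = o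
  · -- split off the shortest and the longest prefix fixing `o`
    obtain ⟨a, ⟨ha1, ha2, ha3, ha4⟩, ha5⟩ := Set.exists_min_image
      {q | q <+: Y :: t ∧ q ≠ [] ∧ q ≠ Y :: t ∧ mk q • o = o} List.length
      ((Y :: t).inits.finite_toSet.subset fun q hq => (List.mem_inits _ _).2 hq.1) hgood
    obtain ⟨c, ⟨⟨b, hcb⟩, hc2, hc3, hc4⟩, hc5⟩ := Set.exists_max_image
      {q | q <+: Y :: t ∧ q ≠ [] ∧ q ≠ Y :: t ∧ mk q • o = o} List.length
      ((Y :: t).inits.finite_toSet.subset fun q hq => (List.mem_inits _ _).2 hq.1) hgood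
    have hb2 : b ≠ [] := by
      rintro rfl
      exact hc3 (by simpa using hcb)
    have hb4 : mk b • o = o := by
      rw [← hcb, ← mul_mk, mul_smul] at hLo'
      exact MulAction.injective (mk c) (hLo'.trans hc4.symm)
    have ha6 : IsReduced a := hL'.isReduced.infix ha1.isInfix
    have hb6 : IsReduced b := hL'.isReduced.infix (List.IsSuffix.isInfix ⟨c, hcb⟩)
    have hblast : b.getLast? = (Y :: t).getLast? := by
      rw [← hcb, List.getLast?_append, List.getLast?_eq_some_getLast hb2]
      rfl
    have halen : a.length < (Y :: t).length :=
      lt_of_le_of_ne ha1.length_le fun h => ha3 (ha1.eq_of_length h)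
    have hblen : b.length < (Y :: t).length := by
      rw [← hcb, List.length_append]
      have := List.length_pos_iff.2 hc2
      lia
    obtain ⟨x, mid, rfl⟩ := ha6.exists_eq_of_not_isCyclicallyReduced (hmin a ha2 ha4 halen)
    obtain ⟨z, mid', hb⟩ := hb6.exists_eq_of_not_isCyclicallyReduced (hmin b hb2 hb4 hblen)
    obtain rfl : x = Y := (List.cons_prefix_cons.1 ha1).1
    refine Ladder.false_of_conj (hT x) (ha6.mk_ne_one ha2) (hb6.mk_ne_one hb2)
      (fun ε => ⟨_, ?_, perturb_mk_conj x ε mid⟩) fun ε => loc_perturb hb4 ?_ ?_ ?_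
    · refine loc_eval_twists ha4 (fun q h1 h2 h3 => ?_) (by simp)
      refine lt_of_le_of_ne (hle q (h1.trans ha1)) fun h4 => h3 ?_
      refine h1.eq_of_length (le_antisymm h1.length_le (ha5 q ⟨h1.trans ha1, h2, ?_, h4⟩))
      rintro rfl
      exact absurd h1.length_le halen.not_ge
    · intro q h1 h2 h3
      rw [← Node.smul_lt_smul_iff (mk c), hc4, ← mul_smul, mul_mk]
      have hpre : c ++ q <+: x :: t := by
        rw [← hcb]
        exact (List.prefix_append_right_inj c).2 h1
      refine lt_of_le_of_ne (hle _ hpre) fun h4 => ?_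
      have := hc5 (c ++ q) ⟨hpre, by simp [h2], fun h5 => h3 ?_, h4⟩
      · rw [List.length_append] at this
        have := List.length_pos_iff.2 h2
        lia
      · rw [← hcb] at h5
        exact List.append_cancel_left h5
    · intro h
      rw [hb] at h
      obtain rfl : z = x := by simpa using h
      rw [← hblast, hb, ← List.cons_append] at hlast
      exact hlast List.getLast?_concat
    · rwa [hblast]
  · push Not at hgood
    refine Ladder.false_of_shift_mul (hT Y) hR (c := mk (Y :: t))
      fun ε => ⟨_, ?_, perturb_mk_cons Y ε t⟩
    have := loc_eval_twists (o := o) (Y := Y) (ε := ε) (t := t) (u := [])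
    rw [List.append_nil] at this
    exact this hLo' (fun q h1 h2 h3 => lt_of_le_of_ne (hle q h1) (hgood q h1 h2 h3))
      fun _ => hlast

end FreeGroup

/-! ### No isolated points -/

namespace FreeGroup

theorem exists_perturbation {P : Set (FreeGroup (Fin 2))} (hP : IsBiPosCone P)
    (S : Finset (FreeGroup (Fin 2))) (hS : ∀ s ∈ S, s ∈ P) :
    ∃ Q : Set (FreeGroup (Fin 2)), IsBiPosCone Q ∧ (∀ s ∈ S, s ∈ Q) ∧ Q ≠ P := by
  by_contra! hcon
  obtain ⟨_, _, _, hlt⟩ := hP.exists_order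
  have hconj (p : FreeGroup (Fin 2)) {s : FreeGroup (Fin 2)} (hs : 1 < s) : 1 < p⁻¹ * s * p := by
    have := hP.conj_mem p⁻¹ ((hlt s).2 hs)
    rwa [inv_inv, hlt] at this
  obtain ⟨e, he⟩ : ∃ e : FreeGroup (Fin 2), 1 < e := by
    rcases (of_ne_one (0 : Fin 2)).lt_or_gt with h | h
    · exact ⟨_, one_lt_inv'.2 h⟩
    · exact ⟨_, h⟩
  -- a positive element below all relevant conjugates of elements of `S`
  obtain ⟨h, hh, hle⟩ : ∃ h : FreeGroup (Fin 2), 1 < h ∧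
      ∀ s ∈ S, ∀ q, q <+: s.toWord → h ≤ (mk q)⁻¹ * s * mk q := by
    obtain ⟨h, h1, h2⟩ := (insert e (S.biUnion fun s =>
      s.toWord.inits.toFinset.image fun q => (mk q)⁻¹ * s * mk q)).exists_min_image id ⟨e, by simp⟩
    refine ⟨h, ?_, fun s hs q hq => h2 _ ?_⟩
    · rcases Finset.mem_insert.1 h1 with rfl | h1
      · exact he
      · obtain ⟨s, hs, h1⟩ := Finset.mem_biUnion.1 h1
        obtain ⟨q, -, rfl⟩ := Finset.mem_image.1 h1
        exact hconj _ ((hlt s).1 (hS s hs))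
    · exact Finset.mem_insert_of_mem (Finset.mem_biUnion.2 ⟨s, hs, Finset.mem_image.2
        ⟨q, List.mem_toFinset.2 ((List.mem_inits _ _).2 hq), rfl⟩⟩)
  have hT : ∀ (Y : Fin 2 × Bool) ε c, TopPos (perturb (Cut.tiny h) Y ε c) ↔ 1 < c := by
    intro Y ε c
    have hQ := hcon _ (IsBiPosCone.ofAction (perturb (Cut.tiny h) Y ε) (tri_perturb Y ε) hP.inv)
      fun s hs => Or.inl (topPos_perturb Y ε ((hlt s).1 (hS s hs)) fun q hq hfix => by
        refine Cut.smul_tiny_ne hh (hle s hs q hq) ?_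
        rw [mul_smul, mul_smul, hfix, inv_smul_smul])
    rw [← hlt]
    constructor
    · intro hc
      rw [← hQ]
      exact Or.inl hc
    · intro hc
      have hc' := hc
      rw [← hQ] at hc'
      rcases hc' with hc' | ⟨-, hc'⟩
      · exact hc'
      · exact absurd hc' (hP.inv_notMem hc)
  obtain ⟨g, hg, hsmall⟩ := exists_small_conj exists_not_commute hh
    (insert 1 (Finset.univ.image fun k : Fin 2 × Bool => mk [k]))
  have hfix : ∀ x ∈ insert 1 (Finset.univ.image fun k : Fin 2 × Bool => mk [k]),
      (x * g * x⁻¹) • Cut.tiny h = Cut.tiny h := fun x hx =>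
    Cut.smul_tiny_eq hh (hsmall x hx)
  have hgfix : g • Cut.tiny h = Cut.tiny h := by simpa using hfix 1 (by simp)
  obtain ⟨L, hL, hcyc, hLfix⟩ := exists_isCyclicallyReduced
    (MulAction.stabilizer (FreeGroup (Fin 2)) (Cut.tiny h)) hg hgfix
    fun k => hfix (mk [k]) (by simp)
  obtain ⟨m, hm⟩ := Cut.exists_lt_tiny hgfix hg
  exact false_of_topPos_perturb hT ⟨WordChain.single m, WordChain.mem_R.2 hm⟩ hL hcyc hLfix

end FreeGroup

/-- The space `O(F₂)` of bi-invariant positive cones of the free group on two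
generators has no isolated points. -/
theorem OSpace_freeGroup_two_no_isolated_points :
    ∀ p : OSpace (FreeGroup (Fin 2)),
      ¬ IsOpen ({p} : Set (OSpace (FreeGroup (Fin 2)))) := by
  classical
  rintro ⟨p, hp⟩ hopen
  obtain ⟨U, hU, hUp⟩ := isOpen_induced_iff.1 hopen
  have hpU : p ∈ U := by
    have : (⟨p, hp⟩ : OSpace (FreeGroup (Fin 2))) ∈ Subtype.val ⁻¹' U := by rw [hUp]; rfl
    exact this
  obtain ⟨I, u, hu, hIU⟩ := isOpen_pi_iff.1 hU p hpU
  obtain ⟨Q, hQ, hSQ, hne⟩ := FreeGroup.exists_perturbation hp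
    ((I ∪ I.image fun g => g⁻¹).filter fun g => p g = true)
    fun s hs => (Finset.mem_filter.1 hs).2
  have hQ' : IsBiPosCone {g | decide (g ∈ Q) = true} := by simpa using hQ
  have hmem : (⟨fun g => decide (g ∈ Q), hQ'⟩ : OSpace (FreeGroup (Fin 2))) ∈
      Subtype.val ⁻¹' U := by
    refine hIU fun g hg => ?_
    have hagree : decide (g ∈ Q) = p g := by
      cases hpg : p g with
      | true => exact decide_eq_true (hSQ g (by simpa [hpg] using Or.inl hg))
      | false =>
        refine decide_eq_false fun hgQ => ?_
        have hg1 : g ≠ 1 := fun h => hQ.one_notMem (h ▸ hgQ)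
        rcases hp.mem_or_inv_mem hg1 with h | h
        · simp [hpg] at h
        · refine hQ.inv_notMem hgQ (hSQ g⁻¹ (Finset.mem_filter.2 ⟨?_, h⟩))
          exact Finset.mem_union_right _ (Finset.mem_image_of_mem _ hg)
    change decide (g ∈ Q) ∈ u g
    rw [hagree]
    exact (hu g hg).2
  rw [hUp, Set.mem_singleton_iff, Subtype.mk.injEq] at hmem
  refine hne ?_
  rw [← hmem]
  simp
end
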